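/- arXiv:2105.09547 — 7 statements merged into one kernel-verified Lean document; each statement's English description precedes it below -/
import Mathlib

section
/- With the standing setup, for any ideal C of 𝓡 = R[X]/⟨X^n−λ⟩ there is a unique sequence of monic polynomials g_0(X), g_1(X), …, g_{ℓ−1}(X) ∈ R[X] such that: (g1) g_0(X) ∣ (X^n−λ) in R[X] and g_v(X) ∣ g_{v−1}(X) for v = 1, …, ℓ−1; and (g2) C = ⟨g_0(X) + π g_1(X) + ⋯ + π^{ℓ−1} g_{ℓ−1}(X)⟩. -/
open Polynomial

/-- If `x` is congruent modulo `J` to a nilpotent element, and `x` is annihilated modulo `J` by an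
element coprime to it, then `x ∈ J`. -/
theorem Ideal.mem_of_isCoprime_of_isNilpotent {A : Type*} [CommRing A] {J : Ideal A} {x y t : A}
    (hxy : IsCoprime x y) (hmul : x * y ∈ J) (ht : IsNilpotent t) (hadd : x + t ∈ J) :
    x ∈ J := by
  obtain ⟨N, hN⟩ := ht
  have hxN : x ^ N ∈ J := by
    have h : Ideal.Quotient.mk J x = -Ideal.Quotient.mk J t := by
      rw [eq_neg_iff_add_eq_zero, ← map_add]
      exact Ideal.Quotient.eq_zero_iff_mem.2 hadd
    rw [← Ideal.Quotient.eq_zero_iff_mem, map_pow, h, neg_pow, ← map_pow, hN, map_zero, mul_zero]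
  obtain ⟨a, b, hab⟩ := hxy.pow_left (m := N)
  have : x = (a * x) * x ^ N + b * (x * y) := by linear_combination (-x) * hab
  rw [this]
  exact J.add_mem (J.mul_mem_left _ hxN) (J.mul_mem_left _ hmul)

namespace Polynomial

variable {R : Type*} [CommRing R]

/-- Hensel's lemma for a nilpotent ideal: a coprime factorization into monic polynomials lifts. -/
theorem exists_monic_mul_eq_of_isCoprime_map {I : Ideal R} (hI : IsNilpotent I) {f : R[X]}
    (hf : f.Monic) {a b : (R ⧸ I)[X]} (ha : a.Monic) (hb : b.Monic)
    (hab : f.map (Ideal.Quotient.mk I) = a * b) (hcop : IsCoprime a b) :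
    ∃ A B : R[X], A.Monic ∧ B.Monic ∧ f = A * B ∧ A.map (Ideal.Quotient.mk I) = a := by
  rcases subsingleton_or_nontrivial (R ⧸ I) with hs | hs
  · exact ⟨f, 1, hf, monic_one, (mul_one f).symm, Subsingleton.elim _ _⟩
  have hn : f.natDegree = a.natDegree + b.natDegree := by
    rw [← ha.natDegree_mul hb, ← hab, hf.natDegree_map]
  let P : MonicDegreeEq R f.natDegree := .mk f hf rfl
  let e := UniversalCoprimeFactorizationRing.homEquiv (R ⧸ I) a.natDegree b.natDegree hn P
  let φ := e.symm ⟨(.mk a ha rfl, .mk b hb rfl), hab.symm, hcop⟩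
  let ψ := Algebra.FormallySmooth.lift I hI φ
  have hψ : (Ideal.Quotient.mkₐ R I).comp ψ = φ := Algebra.FormallySmooth.comp_lift I hI φ
  let q := UniversalCoprimeFactorizationRing.homEquiv R a.natDegree b.natDegree hn P ψ
  refine ⟨q.1.1.1, q.1.2.1, q.1.1.monic, q.1.2.monic, ?_, ?_⟩
  · exact (q.2.1.trans Polynomial.map_id).symm
  · have h := UniversalCoprimeFactorizationRing.homEquiv_comp_fst R a.natDegree b.natDegree hn P
      ψ (Ideal.Quotient.mkₐ R I)
    rw [hψ] at h
    have h' : e φ = ⟨(.mk a ha rfl, .mk b hb rfl), hab.symm, hcop⟩ := e.apply_symm_apply _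
    have h'' := congrArg (fun z => z.1.1.1) h'
    exact ((congrArg Subtype.val h).symm.trans h'')

/-- An ideal containing a monic separable polynomial `f` and a nilpotent constant generating a
maximal ideal is generated by that constant and a monic divisor of `f`. -/
theorem exists_monic_dvd_span_pair_eq {π : R} (hπ : IsNilpotent π)
    (hmax : (Ideal.span {π}).IsMaximal) {f : R[X]} (hf : f.Monic) (hsep : f.Separable)
    {T : Ideal R[X]} (hfT : f ∈ T) (hπT : C π ∈ T) :
    ∃ g : R[X], g.Monic ∧ g ∣ f ∧ T = Ideal.span {g, C π} := by
  let _ := Ideal.Quotient.field (Ideal.span {π})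
  have hker : ∀ x : R[X], x.map (Ideal.Quotient.mk (Ideal.span {π})) = 0 ↔ C π ∣ x := by
    intro x
    rw [C_dvd_iff_dvd_coeff, Polynomial.ext_iff]
    simp [Ideal.Quotient.eq_zero_iff_mem, Ideal.mem_span_singleton]
  have hsurj := Polynomial.map_surjective _ (Ideal.Quotient.mk_surjective (I := Ideal.span {π}))
  obtain ⟨a₀, ha₀⟩ := (IsPrincipalIdealRing.principal
    (T.map (mapRingHom (Ideal.Quotient.mk (Ideal.span {π}))))).principal
  have hmem : f.map (Ideal.Quotient.mk (Ideal.span {π})) ∈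
      T.map (mapRingHom (Ideal.Quotient.mk (Ideal.span {π}))) :=
    Ideal.mem_map_of_mem (mapRingHom (Ideal.Quotient.mk (Ideal.span {π}))) hfT
  have hfm : (f.map (Ideal.Quotient.mk (Ideal.span {π}))).Monic := hf.map _
  have hane : a₀ ≠ 0 := by
    rintro rfl
    rw [ha₀] at hmem
    exact hfm.ne_zero (by simpa using hmem)
  obtain ⟨a, ha, haT⟩ : ∃ a : (R ⧸ Ideal.span {π})[X], a.Monic ∧
      T.map (mapRingHom (Ideal.Quotient.mk (Ideal.span {π}))) = Ideal.span {a} := by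
    classical
    refine ⟨normalize a₀, monic_normalize hane, ?_⟩
    rw [ha₀]
    exact Ideal.span_singleton_eq_span_singleton.2 (associated_normalize a₀)
  rw [haT, Ideal.mem_span_singleton] at hmem
  obtain ⟨b, hb⟩ := hmem
  have hbm : b.Monic := ha.of_mul_monic_left (hb ▸ hfm)
  have hcop : IsCoprime a b := by
    apply Separable.isCoprime
    rw [← hb]
    exact hsep.map
  have hnil : IsNilpotent (Ideal.span {π}) := by
    obtain ⟨N, hN⟩ := hπ
    exact ⟨N, by rw [Ideal.span_singleton_pow, hN]; simp⟩
  obtain ⟨A, B, hA, -, hAB, hAa⟩ := exists_monic_mul_eq_of_isCoprime_map hnil hf ha hbm hb hcop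
  refine ⟨A, hA, ⟨B, hAB⟩, le_antisymm (fun x hx => ?_) ?_⟩
  · have hx' : x.map (Ideal.Quotient.mk (Ideal.span {π})) ∈
        T.map (mapRingHom (Ideal.Quotient.mk (Ideal.span {π}))) :=
      Ideal.mem_map_of_mem (mapRingHom (Ideal.Quotient.mk (Ideal.span {π}))) hx
    rw [haT, Ideal.mem_span_singleton] at hx'
    obtain ⟨c, hc⟩ := hx'
    obtain ⟨c, rfl⟩ := hsurj c
    obtain ⟨d, hd⟩ := (hker (x - A * c)).1 (by
      rw [Polynomial.map_sub, Polynomial.map_mul, hAa, hc, sub_self])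
    exact Ideal.mem_span_pair.2 ⟨c, d, by linear_combination -hd⟩
  · have hAT : A ∈ T := by
      have : a ∈ T.map (mapRingHom (Ideal.Quotient.mk (Ideal.span {π}))) := by
        rw [haT]
        exact Ideal.mem_span_singleton_self a
      obtain ⟨y, hy, hya⟩ := (Ideal.mem_map_iff_of_surjective _ hsurj).1 this
      obtain ⟨d, hd⟩ := (hker (A - y)).1 (by
        rw [Polynomial.map_sub, hAa, sub_eq_zero]
        exact hya.symm)
      have : A = y + d * C π := by linear_combination hd
      rw [this]
      exact T.add_mem hy (T.mul_mem_left _ hπT)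
    rw [Ideal.span_le]
    rintro x (rfl | rfl)
    exacts [hAT, hπT]

/-- Divisibility between divisors of a separable polynomial can be tested modulo a nilpotent. -/
theorem Separable.dvd_of_mem_span_pair {f g d t : R[X]} (hsep : f.Separable) (hg : g ∣ f)
    (hd : d ∣ f) (ht : IsNilpotent t) (hmem : g ∈ Ideal.span {d, t}) : d ∣ g := by
  obtain ⟨k, rfl⟩ := hg
  obtain ⟨a, b, hab⟩ := hsep.isCoprime
  obtain ⟨c, e, hce⟩ := Ideal.mem_span_pair.1 hmem
  obtain ⟨u, hu⟩ : IsUnit (1 - a * e * t) := (Commute.all _ _).isNilpotent_mul_left ht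
    |>.isUnit_one_sub
  have hcop : IsCoprime d k := by
    refine ⟨↑u⁻¹ * (a * c), ↑u⁻¹ * b, ?_⟩
    have hu' : (↑u⁻¹ : R[X]) * (1 - a * e * t) = 1 := by rw [← hu, Units.inv_mul]
    linear_combination hu' + (↑u⁻¹ : R[X]) * hab + (↑u⁻¹ : R[X]) * a * hce
  exact hcop.dvd_of_dvd_mul_right hd

/-- For a divisor chain `⋯ ∣ g 1 ∣ g 0 ∣ f` with `f ∈ J` separable, an ideal `J` containing
`∑ t ^ v * g v` contains each summand. -/
theorem Separable.pow_mul_mem_of_sum_mem {t : R[X]} (ht : IsNilpotent t) (m : ℕ) {f : R[X]}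
    {g : ℕ → R[X]} {J : Ideal R[X]} (hsep : f.Separable) (hg0 : g 0 ∣ f)
    (hg : ∀ v, g (v + 1) ∣ g v) (hfJ : f ∈ J) (hsum : ∑ v ∈ Finset.range m, t ^ v * g v ∈ J) :
    ∀ v < m, t ^ v * g v ∈ J := by
  induction m generalizing f g J with
  | zero => simp
  | succ m ih =>
    have hs : ∑ v ∈ Finset.range (m + 1), t ^ v * g v =
        g 0 + t * ∑ v ∈ Finset.range m, t ^ v * g (v + 1) := by
      rw [Finset.sum_range_succ', Finset.mul_sum, add_comm, pow_zero, one_mul]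
      congr 1
      exact Finset.sum_congr rfl fun v _ => by ring
    rw [hs] at hsum
    have hg0J : g 0 ∈ J := by
      obtain ⟨k, rfl⟩ := hg0
      exact Ideal.mem_of_isCoprime_of_isNilpotent hsep.isCoprime hfJ
        ((Commute.all _ _).isNilpotent_mul_right ht) hsum
    let J' : Ideal R[X] := Submodule.comap (LinearMap.mulLeft R[X] t) J
    have key := ih (f := g 0) (g := fun v => g (v + 1)) (J := J') (hsep.of_dvd hg0) (hg 0)
      (fun v => hg (v + 1)) (J.mul_mem_left t hg0J) ((J.add_mem_iff_right hg0J).1 hsum)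
    rintro (_ | v) hv
    · simpa using hg0J
    · have : t * (t ^ v * g (v + 1)) ∈ J := key v (by omega)
      rwa [← mul_assoc, ← pow_succ'] at this

theorem Monic.dvd_antisymm {a b : R[X]} (ha : a.Monic) (hb : b.Monic) (hab : a ∣ b)
    (hba : b ∣ a) : a = b := by
  obtain ⟨c, rfl⟩ := hab
  obtain ⟨d, hd⟩ := hba
  have hcd : c * d = 1 := ha.isRegular.left (by simpa [mul_assoc] using hd.symm)
  rw [(ha.of_mul_monic_left hb).eq_one_of_isUnit (.of_mul_eq_one d hcd), mul_one]

/-- Cancelling `π ^ v` modulo a monic polynomial. -/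
theorem Monic.mem_span_pair_of_pow_mul_mem {π : R} (hunit : ∀ x : R, ¬IsUnit x → π ∣ x) {v : ℕ}
    (hv : π ^ v ≠ 0) {g h : R[X]} (hg : g.Monic)
    (hmem : C π ^ v * h ∈ Ideal.span {g, C π ^ (v + 1)}) : h ∈ Ideal.span {g, C π} := by
  obtain ⟨a, b, hab⟩ := Ideal.mem_span_pair.1 hmem
  have hdvd : g ∣ C (π ^ v) * (h - C π * b) := ⟨a, by rw [C_pow]; linear_combination -hab⟩
  have hzero : C (π ^ v) * ((h - C π * b) %ₘ g) = 0 := by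
    rw [← smul_eq_C_mul, ← smul_modByMonic, smul_eq_C_mul, (modByMonic_eq_zero_iff_dvd hg).2 hdvd]
  obtain ⟨d, hd⟩ : C π ∣ (h - C π * b) %ₘ g := by
    rw [C_dvd_iff_dvd_coeff]
    intro i
    refine hunit _ fun hu => hv ?_
    have := congrArg (fun p => p.coeff i) hzero
    simpa only [coeff_C_mul, coeff_zero, hu.mul_left_eq_zero] using this
  have hdiv := modByMonic_add_div (h - C π * b) g
  exact Ideal.mem_span_pair.2 ⟨(h - C π * b) /ₘ g, d + b, by linear_combination hdiv - hd⟩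

/-- Every term of a divisor chain sum, and `f` itself, lie in the ideal generated by `g v` and
`t ^ (v + 1)`. -/
theorem span_sum_pair_le {t f : R[X]} {g : ℕ → R[X]} (hg0 : g 0 ∣ f) (hg : ∀ v, g (v + 1) ∣ g v)
    (m v : ℕ) : Ideal.span {∑ u ∈ Finset.range m, t ^ u * g u, f} ≤
      Ideal.span {g v, t ^ (v + 1)} := by
  have hanti : ∀ u w, u ≤ w → g w ∣ g u := fun u w huw =>
    Nat.le_induction dvd_rfl (fun w _ ih => (hg w).trans ih) w huw
  have h1 : g v ∈ Ideal.span {g v, t ^ (v + 1)} := Ideal.subset_span (by simp)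
  have h2 : t ^ (v + 1) ∈ Ideal.span {g v, t ^ (v + 1)} := Ideal.subset_span (by simp)
  rw [Ideal.span_le]
  rintro x (rfl | rfl)
  · refine Ideal.sum_mem _ fun u _ => ?_
    rcases le_or_gt u v with huv | huv
    · exact Ideal.mem_of_dvd _ ((hanti u v huv).mul_left _) h1
    · exact Ideal.mem_of_dvd _ ((pow_dvd_pow t huv).mul_right _) h2
  · exact Ideal.mem_of_dvd _ ((hanti 0 v v.zero_le).trans hg0) h1

/-- Existence of the generating divisor chain of an ideal containing `f`. -/
theorem exists_chain_eq_span {π : R} {m : ℕ} (hm : π ^ m = 0)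
    (hmax : (Ideal.span {π}).IsMaximal) {f : R[X]} (hf : f.Monic) (hsep : f.Separable)
    {J : Ideal R[X]} (hfJ : f ∈ J) :
    ∃ g : ℕ → R[X], (∀ v, (g v).Monic) ∧ g 0 ∣ f ∧ (∀ v, g (v + 1) ∣ g v) ∧
      J = Ideal.span {∑ v ∈ Finset.range m, C π ^ v * g v, f} := by
  have hπ : IsNilpotent (C π) := ⟨m, by rw [← C_pow, hm, C_0]⟩
  let Q : ℕ → Ideal R[X] := fun v => Submodule.comap (LinearMap.mulLeft R[X] (C π ^ v)) J
  have hQ : ∀ v x, x ∈ Q v ↔ C π ^ v * x ∈ J := fun _ _ => Iff.rfl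
  have hfQ : ∀ v, f ∈ Q v := fun v => J.mul_mem_left _ hfJ
  have hex : ∀ v, ∃ g : R[X], g.Monic ∧ g ∣ f ∧
      Q v ⊔ Ideal.span {C π} = Ideal.span {g, C π} := fun v =>
    exists_monic_dvd_span_pair_eq ⟨m, hm⟩ hmax hf hsep (Ideal.mem_sup_left (hfQ v))
      (Ideal.mem_sup_right (Ideal.mem_span_singleton_self _))
  choose g hgm hgf hgQ using hex
  have hgmem : ∀ v, g v ∈ Q v := by
    intro v
    have h : g v ∈ Q v ⊔ Ideal.span {C π} := by
      rw [hgQ]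
      exact Ideal.subset_span (by simp)
    obtain ⟨y, hy, z, hz, hyz⟩ := Submodule.mem_sup.1 h
    obtain ⟨d, rfl⟩ := Ideal.mem_span_singleton.1 hz
    obtain ⟨k, hk⟩ := hgf v
    refine Ideal.mem_of_isCoprime_of_isNilpotent (y := k) (t := -(C π * d)) ?_ (hk ▸ hfQ v)
      ((Commute.all _ _).isNilpotent_mul_right hπ).neg ?_
    · exact Separable.isCoprime (hk ▸ hsep)
    · rwa [← hyz, add_neg_cancel_right]
  have hchain : ∀ v, g (v + 1) ∣ g v := by
    intro v
    refine hsep.dvd_of_mem_span_pair (hgf v) (hgf _) hπ ?_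
    rw [← hgQ]
    refine Ideal.mem_sup_left ?_
    rw [hQ, pow_succ', mul_assoc]
    exact J.mul_mem_left _ (hgmem v)
  refine ⟨g, hgm, hgf 0, hchain, le_antisymm ?_ ?_⟩
  · set K := Ideal.span {∑ v ∈ Finset.range m, C π ^ v * g v, f}
    have hKJ := hsep.pow_mul_mem_of_sum_mem (J := K) hπ m (hgf 0) hchain
      (Ideal.subset_span (by simp)) (Ideal.subset_span (by simp))
    have happrox : ∀ v ≤ m, ∀ x ∈ J, ∃ y, x - C π ^ v * y ∈ K ∧ C π ^ v * y ∈ J := by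
      intro v
      induction v with
      | zero => exact fun _ x hx => ⟨x, by simp, by simpa using hx⟩
      | succ v ih =>
        intro hv x hx
        obtain ⟨y, hxy, hy⟩ := ih (by omega) x hx
        have hyT : y ∈ Ideal.span {g v, C π} := hgQ v ▸ Ideal.mem_sup_left hy
        obtain ⟨a, b, rfl⟩ := Ideal.mem_span_pair.1 hyT
        refine ⟨b, ?_, ?_⟩
        · have : x - C π ^ (v + 1) * b =
              (x - C π ^ v * (a * g v + b * C π)) + a * (C π ^ v * g v) := by ring
          rw [this]
          exact K.add_mem hxy (K.mul_mem_left _ (hKJ v (by omega)))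
        · have : C π ^ (v + 1) * b =
              C π ^ v * (a * g v + b * C π) - a * (C π ^ v * g v) := by ring
          rw [this]
          exact J.sub_mem hy (J.mul_mem_left _ (hgmem v))
    intro x hx
    obtain ⟨y, hy, -⟩ := happrox m le_rfl x hx
    simpa [← C_pow, hm] using hy
  · rw [Ideal.span_le]
    rintro x (rfl | rfl)
    exacts [Ideal.sum_mem _ fun v _ => hgmem v, hfJ]

/-- Uniqueness of the generating divisor chain: two chains with the same ideal agree. -/
theorem chain_dvd_of_span_eq {π : R} (hunit : ∀ x : R, ¬IsUnit x → π ∣ x) (hπ : IsNilpotent π)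
    {m : ℕ} {f : R[X]} (hsep : f.Separable) {g g' : ℕ → R[X]} (hgm : ∀ v, (g v).Monic)
    (hg0 : g 0 ∣ f) (hg : ∀ v, g (v + 1) ∣ g v) (hg0' : g' 0 ∣ f) (hg' : ∀ v, g' (v + 1) ∣ g' v)
    (hspan : Ideal.span {∑ v ∈ Finset.range m, C π ^ v * g v, f} =
      Ideal.span {∑ v ∈ Finset.range m, C π ^ v * g' v, f})
    {v : ℕ} (hv : v < m) (hne : π ^ v ≠ 0) : g v ∣ g' v := by
  have hπ' : IsNilpotent (C π) := hπ.map C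
  have hdvd : ∀ {h : ℕ → R[X]}, h 0 ∣ f → (∀ v, h (v + 1) ∣ h v) → ∀ v, h v ∣ f :=
    fun h0 hs v => Nat.rec h0 (fun v ih => (hs v).trans ih) v
  refine hsep.dvd_of_mem_span_pair (hdvd hg0' hg' v) (hdvd hg0 hg v) hπ' ?_
  refine (hgm v).mem_span_pair_of_pow_mul_mem hunit hne (span_sum_pair_le hg0 hg m v ?_)
  rw [hspan]
  exact hsep.pow_mul_mem_of_sum_mem hπ' m hg0' hg' (Ideal.subset_span (by simp))
    (Ideal.subset_span (by simp)) v hv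

end Polynomial

/-- An ideal of a quotient by `f` is generated by the class of `x` exactly when its preimage is
generated by `x` and `f`. -/
theorem Ideal.Quotient.eq_span_mk_iff {A : Type*} [CommRing A] {f x : A}
    {I : Ideal (A ⧸ Ideal.span {f})} :
    I = Ideal.span {Ideal.Quotient.mk (Ideal.span {f}) x} ↔
      I.comap (Ideal.Quotient.mk (Ideal.span {f})) = Ideal.span {x, f} := by
  have h : (Ideal.span {Ideal.Quotient.mk (Ideal.span {f}) x}).comap
      (Ideal.Quotient.mk (Ideal.span {f})) = Ideal.span {x, f} := by
    rw [← Set.image_singleton, ← Ideal.map_span,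
      Ideal.comap_map_of_surjective _ Ideal.Quotient.mk_surjective, ← RingHom.ker_eq_comap_bot,
      Ideal.mk_ker, ← Ideal.span_union, Set.singleton_union]
  rw [← h]
  exact (Ideal.comap_injective_of_surjective _ Ideal.Quotient.mk_surjective).eq_iff.symm

section ChainRing

variable {R : Type*} [CommRing R] {π : R}

theorem dvd_of_not_isUnit_of_chain (hchain : ∀ I J : Ideal R, I ≤ J ∨ J ≤ I)
    (hJ : Ideal.jacobson (⊥ : Ideal R) = Ideal.span {π}) {x : R} (hx : ¬IsUnit x) : π ∣ x := by
  rw [← Ideal.mem_span_singleton, ← hJ, Ideal.jacobson, Ideal.mem_sInf]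
  rintro M ⟨-, hM⟩
  obtain ⟨N, hN, hxN⟩ := exists_max_ideal_of_mem_nonunits hx
  rcases hchain M N with h | h
  · exact hM.eq_of_le hN.ne_top h ▸ hxN
  · exact h hxN

theorem isMaximal_span_of_nonunits [Nontrivial R] (hunit : ∀ x : R, ¬IsUnit x → π ∣ x)
    (hπ : IsNilpotent π) : (Ideal.span {π}).IsMaximal := by
  obtain ⟨M, hM⟩ := Ideal.exists_maximal R
  have hle : M ≤ Ideal.span {π} := fun x hx => Ideal.mem_span_singleton.2
    (hunit x fun hu => hM.ne_top (M.eq_top_of_isUnit_mem hx hu))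
  have hne : Ideal.span {π} ≠ ⊤ := by
    rw [Ne, Ideal.span_singleton_eq_top]
    exact fun h => not_isUnit_zero (M₀ := R) (by
      obtain ⟨k, hk⟩ := hπ
      exact hk ▸ h.pow k)
  exact hM.eq_of_le hne hle ▸ hM

/-- An integer prime to the residue characteristic is a unit. -/
theorem isUnit_natCast_of_coprime (hunit : ∀ x : R, ¬IsUnit x → π ∣ x)
    (hmax : (Ideal.span {π}).IsMaximal) {p r n : ℕ}
    (hcard : Nat.card (R ⧸ Ideal.span {π}) = p ^ r) (hnp : Nat.Coprime n p) :
    IsUnit (n : R) := by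
  by_contra hu
  have hn : (n : R) ∈ Ideal.span {π} := Ideal.mem_span_singleton.2 (hunit _ hu)
  have hp : (p : R) ∈ Ideal.span {π} := by
    refine hmax.isPrime.mem_of_pow_mem r ?_
    rw [← Ideal.Quotient.eq_zero_iff_mem, ← Nat.cast_pow, ← hcard, map_natCast]
    simpa [nsmul_eq_mul] using card_nsmul_eq_zero' (x := (1 : R ⧸ Ideal.span {π}))
  have hcop : IsCoprime (n : R) (p : R) := by
    simpa using (Nat.isCoprime_iff_coprime.2 hnp).map (Int.castRingHom R)
  obtain ⟨a, b, hab⟩ := hcop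
  refine hmax.ne_top ((Ideal.eq_top_iff_one _).2 (hab ▸ ?_))
  exact Ideal.add_mem _ (Ideal.mul_mem_left _ _ hn) (Ideal.mul_mem_left _ _ hp)

end ChainRing

/-- With the standing setup, any ideal `C` of `𝓡 = R[X]/⟨X^n−λ⟩` has a unique sequence of
monic polynomials `g_0, g_1, …, g_{ℓ−1} ∈ R[X]` with (g1) `g_0 ∣ X^n−λ` and
`g_v ∣ g_{v−1}` for `v = 1,…,ℓ−1`, and (g2) `C = ⟨g_0 + πg_1 + ⋯ + π^{ℓ−1}g_{ℓ−1}⟩`. -/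
theorem stmt_7 {R : Type*} [CommRing R] [Fintype R]
    (hchain : ∀ I J : Ideal R, I ≤ J ∨ J ≤ I)
    (π : R) (hJ : Ideal.jacobson (⊥ : Ideal R) = Ideal.span {π})
    (ℓ : ℕ) (hℓ : 0 < ℓ) (hnil : π ^ ℓ = 0) (hnil' : π ^ (ℓ - 1) ≠ 0)
    (p r : ℕ) (hp : p.Prime) (hcard : Nat.card (R ⧸ Ideal.span {π}) = p ^ r)
    (n : ℕ) (hn : 1 < n) (hnp : Nat.Coprime n p)
    (lam : R) (hlam : IsUnit lam)
    (I : Ideal (Polynomial R ⧸ Ideal.span {X ^ n - Polynomial.C lam})) :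
    ∃! g : Fin ℓ → Polynomial R,
      (∀ v, (g v).Monic) ∧
      g ⟨0, hℓ⟩ ∣ (X ^ n - Polynomial.C lam) ∧
      (∀ v : ℕ, ∀ hv : v + 1 < ℓ, g ⟨v + 1, hv⟩ ∣ g ⟨v, Nat.lt_of_succ_lt hv⟩) ∧
      I = Ideal.span {Ideal.Quotient.mk (Ideal.span {X ^ n - Polynomial.C lam})
        (∑ v : Fin ℓ, Polynomial.C (π ^ (v : ℕ)) * g v)} := by
  have hnt : Nontrivial R := ⟨⟨_, _, hnil'⟩⟩
  have hπ : IsNilpotent π := ⟨ℓ, hnil⟩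
  have hunit : ∀ x : R, ¬IsUnit x → π ∣ x := fun x => dvd_of_not_isUnit_of_chain hchain hJ
  have hmax := isMaximal_span_of_nonunits hunit hπ
  have hsep : (X ^ n - C lam : R[X]).Separable := by
    obtain ⟨u, rfl⟩ := hlam
    exact separable_X_pow_sub_C_unit u (isUnit_natCast_of_coprime hunit hmax hcard hnp)
  have hmonic : (X ^ n - C lam : R[X]).Monic := monic_X_pow_sub_C lam (by omega)
  have hne : ∀ v < ℓ, π ^ v ≠ 0 := fun v hv h =>
    hnil' (pow_eq_zero_of_le (by omega) h)
  have hsum : ∀ h : ℕ → R[X], ∑ v : Fin ℓ, C (π ^ (v : ℕ)) * h v =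
      ∑ v ∈ Finset.range ℓ, C π ^ v * h v := fun h => by
    simp only [C_pow]
    exact Fin.sum_univ_eq_sum_range (fun v => C π ^ v * h v) ℓ
  obtain ⟨g, hgm, hg0, hg, hgJ⟩ := exists_chain_eq_span hnil hmax hmonic hsep
    (J := I.comap (Ideal.Quotient.mk (Ideal.span {X ^ n - C lam})))
    (by simp [Ideal.mem_comap, Ideal.Quotient.mk_singleton_self])
  refine ⟨fun v => g v, ⟨fun v => hgm v, hg0, fun v _ => hg v, ?_⟩, ?_⟩
  · rw [Ideal.Quotient.eq_span_mk_iff, hsum, hgJ]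
  · rintro k ⟨hkm, hk0, hk, hkI⟩
    let k' : ℕ → R[X] := fun v => if hv : v < ℓ then k ⟨v, hv⟩ else 1
    have hk'v : ∀ v : Fin ℓ, k' v = k v := fun v => dif_pos v.2
    have hk'm : ∀ v, (k' v).Monic := by
      intro v
      by_cases hv : v < ℓ
      · simpa only [k', dif_pos hv] using hkm ⟨v, hv⟩
      · simpa only [k', dif_neg hv] using monic_one
    have hk'0 : k' 0 ∣ X ^ n - C lam := by simpa only [k', dif_pos hℓ] using hk0
    have hk' : ∀ v, k' (v + 1) ∣ k' v := by
      intro v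
      by_cases hv : v + 1 < ℓ
      · simpa only [k', dif_pos hv, dif_pos (Nat.lt_of_succ_lt hv)] using hk v hv
      · simp only [k', dif_neg hv, one_dvd]
    have hspan : Ideal.span {∑ v ∈ Finset.range ℓ, C π ^ v * k' v, X ^ n - C lam} =
        Ideal.span {∑ v ∈ Finset.range ℓ, C π ^ v * g v, X ^ n - C lam} := by
      rw [← hgJ, ← hsum, Ideal.Quotient.eq_span_mk_iff.1 hkI]
      simp only [hk'v]
    funext v
    rw [← hk'v]
    exact (hk'm v).dvd_antisymm (hgm v)
      (chain_dvd_of_span_eq hunit hπ hsep hk'm hk'0 hk' hg0 hg hspan v.2 (hne v v.2))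
      (chain_dvd_of_span_eq hunit hπ hsep hgm hg0 hg hk'0 hk' hspan.symm v.2 (hne v v.2))
end

section
/- With the standing setup, for any ideal C of 𝓡 = R[X]/⟨X^n−λ⟩ there is a unique sequence of monic polynomials h_0(X), h_1(X), …, h_{ℓ−1}(X) ∈ R[X] such that: (h1) h_0(X) ∣ (X^n−λ) in R[X] and h_v(X) ∣ h_{v−1}(X) for v = 1, …, ℓ−1; and (h2) h_0(X) + π h_1(X) + ⋯ + π^{ℓ−1} h_{ℓ−1}(X) is a check polynomial of C, i.e. for every f(X) ∈ 𝓡, f(X) ∈ C if and only if f(X)·(h_0(X) + π h_1(X) + ⋯ + π^{ℓ−1} h_{ℓ−1}(X)) ≡ 0 (mod X^n−λ). -/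
open Polynomial

theorem eq_of_monic_of_dvd_dvd {R : Type*} [CommRing R] {a b : R[X]} (ha : a.Monic)
    (hb : b.Monic) (hab : a ∣ b) (hba : b ∣ a) : a = b := by
  obtain ⟨c, rfl⟩ := hab
  obtain ⟨d, hd⟩ := hba
  have hcd : c * d = 1 := ha.isRegular.left (by
    simp only
    rw [← mul_assoc, ← hd, mul_one])
  rw [(ha.of_mul_monic_left hb).eq_one_of_isUnit (IsUnit.of_mul_eq_one d hcd), mul_one]

section Lifting

variable {R k : Type*} [CommRing R] [Field k] {φ : R →+* k} {π : R} {ℓ : ℕ}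

theorem C_dvd_of_map_eq_zero (hker : RingHom.ker φ = Ideal.span {π}) {f : R[X]}
    (hf : f.map φ = 0) : C π ∣ f := by
  rw [C_dvd_iff_dvd_coeff]
  intro i
  rw [← Ideal.mem_span_singleton, ← hker, RingHom.mem_ker, ← coeff_map, hf, coeff_zero]

theorem map_C_mul_eq_zero (hker : RingHom.ker φ = Ideal.span {π}) (f : R[X]) :
    (C π * f).map φ = 0 := by
  have : φ π = 0 := by
    rw [← RingHom.mem_ker, hker]
    exact Ideal.mem_span_singleton_self π
  simp [this]

theorem isCoprime_of_isCoprime_map (hφ : Function.Surjective φ)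
    (hker : RingHom.ker φ = Ideal.span {π}) (hnil : π ^ ℓ = 0) {a b : R[X]}
    (h : IsCoprime (a.map φ) (b.map φ)) : IsCoprime a b := by
  obtain ⟨u', v', huv⟩ := h
  obtain ⟨u, rfl⟩ := map_surjective φ hφ u'
  obtain ⟨v, rfl⟩ := map_surjective φ hφ v'
  obtain ⟨w, hw⟩ : C π ∣ u * a + v * b - 1 :=
    C_dvd_of_map_eq_zero hker (by simp [huv])
  have hN : IsNilpotent (C π * w) :=
    ⟨ℓ, by rw [mul_pow, ← C_pow, hnil, C_0, zero_mul]⟩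
  obtain ⟨y, hy⟩ := (hN.isUnit_one_add).exists_left_inv
  refine ⟨y * u, y * v, ?_⟩
  linear_combination hy + y * hw

/-- Hensel lifting of a monic factor of a separable polynomial along a nilpotent kernel. -/
theorem exists_monic_dvd_map_eq (hφ : Function.Surjective φ)
    (hker : RingHom.ker φ = Ideal.span {π}) (hnil : π ^ ℓ = 0) {g : R[X]}
    (hsep : g.Separable) {τ : k[X]} (hτ : τ.Monic) (hdvd : τ ∣ g.map φ) :
    ∃ a : R[X], a.Monic ∧ a ∣ g ∧ a.map φ = τ := by
  have key : ∀ m : ℕ, ∃ a b c : R[X], a.Monic ∧ a.map φ = τ ∧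
      g = a * b + C (π ^ (m + 1)) * c := by
    intro m
    induction m with
    | zero =>
      obtain ⟨σ, hσ⟩ := hdvd
      obtain ⟨a, ha, -, hamonic⟩ := lifts_and_degree_eq_and_monic
        ((mem_lifts τ).2 (map_surjective φ hφ τ)) hτ
      obtain ⟨b, hb⟩ := map_surjective φ hφ σ
      obtain ⟨c, hc⟩ : C π ∣ g - a * b :=
        C_dvd_of_map_eq_zero hker (by simp [ha, hb, hσ])
      refine ⟨a, b, c, hamonic, ha, ?_⟩
      rw [zero_add, pow_one]
      linear_combination hc
    | succ m ih =>
      obtain ⟨a, b, c, ha, haτ, hg⟩ := ih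
      have hmap : g.map φ = a.map φ * b.map φ := by
        rw [hg, pow_succ', C_mul, mul_assoc, Polynomial.map_add, map_C_mul_eq_zero hker,
          add_zero, Polynomial.map_mul]
      have hco : IsCoprime a b :=
        isCoprime_of_isCoprime_map hφ hker hnil (Separable.isCoprime (hmap ▸ hsep.map))
      obtain ⟨u, v, huv⟩ := hco
      have hdiv := modByMonic_add_div (v * c) a
      have hdeg : (C (π ^ (m + 1)) * (v * c %ₘ a)).degree < a.degree ∨ Subsingleton R := by
        rcases subsingleton_or_nontrivial R with h | h
        · exact Or.inr h
        · refine Or.inl (lt_of_le_of_lt ?_ (degree_modByMonic_lt (v * c) ha))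
          rw [C_mul']
          exact degree_smul_le _ _
      refine ⟨a + C (π ^ (m + 1)) * (v * c %ₘ a),
        b + C (π ^ (m + 1)) * (u * c + (v * c /ₘ a) * b),
        - C (π ^ m) * (v * c %ₘ a) * (u * c + (v * c /ₘ a) * b), ?_, ?_, ?_⟩
      · rcases hdeg with h | h
        · exact ha.add_of_left h
        · exact Subsingleton.elim _ _
      · rw [pow_succ', C_mul, mul_assoc, Polynomial.map_add, map_C_mul_eq_zero hker,
          add_zero, haτ]
      · simp only [pow_succ, C_mul] at hg ⊢
        linear_combination hg - C (π ^ m) * C π * c * huv - C (π ^ m) * C π * b * hdiv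
  obtain ⟨a, b, c, ha, haτ, hg⟩ := key ℓ
  refine ⟨a, ha, ⟨b, ?_⟩, haτ⟩
  rw [hg, pow_succ, hnil]
  simp

theorem dvd_of_map_dvd_map (hφ : Function.Surjective φ)
    (hker : RingHom.ker φ = Ideal.span {π}) (hnil : π ^ ℓ = 0) {g d h : R[X]}
    (hsep : g.Separable) (hd : d ∣ g) (hh : h ∣ g) (hdh : d.map φ ∣ h.map φ) : d ∣ h := by
  obtain ⟨t, rfl⟩ := hh
  have hco : IsCoprime (h.map φ) (t.map φ) :=
    Separable.isCoprime (by rw [← Polynomial.map_mul]; exact hsep.map)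
  exact (isCoprime_of_isCoprime_map hφ hker hnil
    (hco.of_isCoprime_of_dvd_left hdh)).dvd_of_dvd_mul_right hd

theorem map_dvd_map_of_dvd_C_mul {c : R} (hc : ∀ x, c * x = 0 → φ x = 0) {d h : R[X]}
    (hd : d.Monic) (hdh : d ∣ C c * h) : d.map φ ∣ h.map φ := by
  have hr : C c * (h %ₘ d) = 0 := by
    rw [C_mul', ← smul_modByMonic, ← C_mul']
    exact (modByMonic_eq_zero_iff_dvd hd).2 hdh
  have hmap : (h %ₘ d).map φ = 0 := by
    ext i
    rw [coeff_map, coeff_zero]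
    apply hc
    rw [← coeff_C_mul, hr, coeff_zero]
  have hdiv := congrArg (Polynomial.map φ) (modByMonic_add_div h d)
  rw [Polynomial.map_add, hmap, zero_add, Polynomial.map_mul] at hdiv
  exact ⟨_, hdiv.symm⟩

section CheckPolynomial

variable {g : R[X]} {h : ℕ → R[X]}

theorem dvd_of_le_of_chain (hchain : ∀ v, v + 1 < ℓ → h (v + 1) ∣ h v) {u v : ℕ}
    (huv : u ≤ v) (hv : v < ℓ) : h v ∣ h u := by
  induction v, huv using Nat.le_induction with
  | base => exact dvd_rfl
  | succ v _ ih => exact (hchain v hv).trans (ih (by omega))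

theorem dvd_mul_checkPolynomial_iff (hφ : Function.Surjective φ)
    (hker : RingHom.ker φ = Ideal.span {π}) (hnil : π ^ ℓ = 0)
    (htop : ∀ x, π ^ (ℓ - 1) * x = 0 → φ x = 0) (hsep : g.Separable)
    (h0 : h 0 ∣ g) (hchain : ∀ v, v + 1 < ℓ → h (v + 1) ∣ h v) {d d' : R[X]}
    (hd : d.Monic) (hd' : d'.Monic) (hdd' : d * d' = g) {v : ℕ} (hv : v < ℓ) :
    g ∣ C (π ^ (ℓ - 1 - v)) * d' * ∑ u ∈ Finset.range ℓ, C (π ^ u) * h u ↔ d ∣ h v := by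
  have hcancel : ∀ f : R[X], g ∣ f * d' ↔ d ∣ f := fun f => by
    constructor
    · rintro ⟨e, he⟩
      refine ⟨e, hd'.isRegular.right ?_⟩
      simp only
      rw [he, ← hdd']
      ring
    · intro hf
      rw [← hdd']
      exact mul_dvd_mul_right hf d'
  rw [mul_right_comm, hcancel]
  have hterm : ∀ m u, ℓ ≤ m + u → C (π ^ m) * (C (π ^ u) * h u) = 0 := fun m u hmu => by
    rw [← mul_assoc, ← C_mul, ← pow_add, pow_eq_zero_of_le hmu hnil, C_0, zero_mul]
  constructor
  · intro hdvd
    induction v using Nat.strong_induction_on with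
    | _ v ih =>
      have hlow : ∀ u < v, d ∣ h u := fun u hu => ih u hu (by omega) (by
        have hpow : π ^ (ℓ - 1 - u) = π ^ (v - u) * π ^ (ℓ - 1 - v) := by
          rw [← pow_add]
          congr 1
          omega
        rw [hpow, C_mul, mul_assoc]
        exact hdvd.mul_left _)
      have hsum : d ∣ C (π ^ (ℓ - 1)) * h v := by
        have hrest : d ∣ ∑ u ∈ (Finset.range ℓ).erase v,
            C (π ^ (ℓ - 1 - v)) * (C (π ^ u) * h u) := by
          refine Finset.dvd_sum fun u hu => ?_
          rcases lt_or_ge u v with huv | huv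
          · exact ((hlow u huv).mul_left _).mul_left _
          · have : u ≠ v := Finset.ne_of_mem_erase hu
            rw [hterm _ _ (by omega)]
            exact dvd_zero d
        rw [Finset.mul_sum, ← Finset.add_sum_erase _ _ (Finset.mem_range.2 hv),
          dvd_add_left hrest, ← mul_assoc, ← C_mul, ← pow_add] at hdvd
        rwa [show ℓ - 1 - v + v = ℓ - 1 by omega] at hdvd
      exact dvd_of_map_dvd_map hφ hker hnil hsep ⟨d', hdd'.symm⟩
        ((dvd_of_le_of_chain hchain (Nat.zero_le v) hv).trans h0)
        (map_dvd_map_of_dvd_C_mul htop hd hsum)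
  · intro hdv
    rw [Finset.mul_sum]
    refine Finset.dvd_sum fun u _ => ?_
    rcases le_or_gt u v with huv | huv
    · exact ((hdv.trans (dvd_of_le_of_chain hchain huv hv)).mul_left _).mul_left _
    · rw [hterm _ _ (by omega)]
      exact dvd_zero d

end CheckPolynomial

/-- An ideal containing a separable monic `g` is generated by polynomials `π ^ j * t j`, where the
`t j` form a divisibility chain of monic divisors of `g`. -/
theorem exists_monic_chain_generating (hφ : Function.Surjective φ)
    (hker : RingHom.ker φ = Ideal.span {π}) (hnil : π ^ ℓ = 0) {g : R[X]} (hg : g.Monic)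
    (hsep : g.Separable) (J : Ideal R[X]) (hgJ : g ∈ J) :
    ∃ t : ℕ → R[X], (∀ j, (t j).Monic) ∧ (∀ j, t j ∣ g) ∧ (∀ j, t (j + 1) ∣ t j) ∧
      (∀ j, C (π ^ j) * t j ∈ J) ∧
      ∀ J' : Ideal R[X], (∀ j < ℓ, C (π ^ j) * t j ∈ J') → J ≤ J' := by
  let Q : ℕ → Ideal R[X] := fun j =>
    Submodule.comap (LinearMap.mulLeft R[X] (C (π ^ j))) J
  have hQ : ∀ j f, f ∈ Q j ↔ C (π ^ j) * f ∈ J := fun j f => Iff.rfl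
  let T : ℕ → Ideal k[X] := fun j => (Q j).map (mapRingHom φ)
  have hT : ∀ j (f : k[X]), f ∈ T j ↔ ∃ f' ∈ Q j, f'.map φ = f := fun j f =>
    Ideal.mem_map_iff_of_surjective (mapRingHom φ) (map_surjective φ hφ)
  have hgT : ∀ j, g.map φ ∈ T j := fun j =>
    (hT j _).2 ⟨g, (hQ j g).2 (J.mul_mem_left _ hgJ), rfl⟩
  have hτ : ∀ j, ∃ τ : k[X], τ.Monic ∧ T j = Ideal.span {τ} := fun j => by
    classical
    obtain ⟨σ, hσ⟩ := (IsPrincipalIdealRing.principal (T j)).principal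
    have hσ0 : σ ≠ 0 := by
      rintro rfl
      have := hgT j
      rw [hσ] at this
      have h0 : g.map φ = 0 := by simpa using this
      exact (hg.map φ).ne_zero h0
    refine ⟨normalize σ, monic_normalize hσ0, ?_⟩
    rw [hσ]
    exact Ideal.span_singleton_eq_span_singleton.2 (normalize_associated σ).symm
  choose τ hτm hτT using hτ
  have hlift := fun j => exists_monic_dvd_map_eq hφ hker hnil hsep (hτm j)
    (Ideal.mem_span_singleton.1 (hτT j ▸ hgT j))
  choose t htm htg htτ using hlift
  have htJ : ∀ j, C (π ^ j) * t j ∈ J := fun j => by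
    obtain ⟨f, hf, hfτ⟩ := (hT j (τ j)).1 (by
      rw [hτT j]; exact Ideal.mem_span_singleton_self _)
    obtain ⟨s, hs⟩ := htg j
    have hco : IsCoprime ((t j).map φ) (s.map φ) :=
      Separable.isCoprime (by rw [← Polynomial.map_mul, ← hs]; exact hsep.map)
    obtain ⟨a, b, hab⟩ : IsCoprime f s :=
      isCoprime_of_isCoprime_map hφ hker hnil (by rwa [hfτ, ← htτ j])
    have : C (π ^ j) * t j = a * t j * (C (π ^ j) * f) + b * C (π ^ j) * g := by
      linear_combination (- C (π ^ j) * t j) * hab - b * C (π ^ j) * hs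
    rw [this]
    exact J.add_mem (J.mul_mem_left _ hf) (J.mul_mem_left _ hgJ)
  have hmem : ∀ j f, C (π ^ j) * f ∈ J → (t j).map φ ∣ f.map φ := fun j f hf => by
    rw [htτ j, ← Ideal.mem_span_singleton, ← hτT j]
    exact (hT j _).2 ⟨f, hf, rfl⟩
  refine ⟨t, htm, htg, fun j => ?_, htJ, fun J' hJ' => ?_⟩
  · refine dvd_of_map_dvd_map hφ hker hnil hsep (htg _) (htg _) (hmem _ _ ?_)
    rw [pow_succ', C_mul, mul_assoc]
    exact J.mul_mem_left _ (htJ j)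
  · have key : ∀ i j, i + j = ℓ → ∀ f, C (π ^ j) * f ∈ J → C (π ^ j) * f ∈ J' := by
      intro i
      induction i with
      | zero =>
        intro j hj f _
        rw [show j = ℓ by omega, hnil, C_0, zero_mul]
        exact J'.zero_mem
      | succ i ih =>
        intro j hj f hf
        obtain ⟨c', hc⟩ := hmem j f hf
        obtain ⟨c, rfl⟩ := map_surjective φ hφ c'
        obtain ⟨w, hw⟩ : C π ∣ f - t j * c :=
          C_dvd_of_map_eq_zero hker (by simp [hc])
        have hsplit : C (π ^ (j + 1)) * w = C (π ^ j) * f - c * (C (π ^ j) * t j) := by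
          rw [pow_succ, C_mul]
          linear_combination - C (π ^ j) * hw
        have hwJ : C (π ^ (j + 1)) * w ∈ J := by
          rw [hsplit]
          exact J.sub_mem hf (J.mul_mem_left _ (htJ j))
        have hwJ' := ih (j + 1) (by omega) w hwJ
        have : C (π ^ j) * f = C (π ^ (j + 1)) * w + c * (C (π ^ j) * t j) := by
          rw [hsplit]
          ring
        rw [this]
        exact J'.add_mem hwJ' (J'.mul_mem_left _ (hJ' j (by omega)))
    intro f hf
    simpa using key ℓ 0 (by omega) f (by simpa using hf)

theorem exists_checkPolynomial (hφ : Function.Surjective φ)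
    (hker : RingHom.ker φ = Ideal.span {π}) (hnil : π ^ ℓ = 0)
    (htop : ∀ x, π ^ (ℓ - 1) * x = 0 → φ x = 0) {g : R[X]} (hg : g.Monic)
    (hsep : g.Separable) (J : Ideal R[X]) (hgJ : g ∈ J) :
    ∃ h : ℕ → R[X], (∀ v, (h v).Monic) ∧ h 0 ∣ g ∧ (∀ v, v + 1 < ℓ → h (v + 1) ∣ h v) ∧
      ∀ f, f ∈ J ↔ g ∣ f * ∑ v ∈ Finset.range ℓ, C (π ^ v) * h v := by
  obtain ⟨t, htm, htg, htt, htJ, htgen⟩ :=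
    exists_monic_chain_generating hφ hker hnil hg hsep J hgJ
  choose s hs using htg
  have hsm : ∀ j, (s j).Monic := fun j => (htm j).of_mul_monic_left (hs j ▸ hg)
  have hchain : ∀ v, v + 1 < ℓ → s (ℓ - 1 - (v + 1)) ∣ s (ℓ - 1 - v) := by
    intro v hv
    obtain ⟨j, hj⟩ : ∃ j, ℓ - 1 - v = j + 1 := ⟨ℓ - 1 - v - 1, by omega⟩
    rw [show ℓ - 1 - (v + 1) = j by omega, hj]
    obtain ⟨c, hc⟩ := htt j
    refine ⟨c, (htm (j + 1)).isRegular.left ?_⟩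
    simp only
    rw [← hs (j + 1), hs j, hc]
    ring
  have h0 : s (ℓ - 1 - 0) ∣ g := ⟨t (ℓ - 1), by rw [mul_comm]; exact hs (ℓ - 1)⟩
  have hcheck : ∀ {d d' : R[X]}, d.Monic → d'.Monic → d * d' = g → ∀ {v : ℕ}, v < ℓ → _ :=
    fun hd hd' hdd' _ hv => dvd_mul_checkPolynomial_iff (h := fun v => s (ℓ - 1 - v)) hφ hker
      hnil htop hsep h0 hchain hd hd' hdd' hv
  refine ⟨fun v => s (ℓ - 1 - v), fun v => hsm _, h0, hchain, fun f => ?_⟩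
  set H := ∑ v ∈ Finset.range ℓ, C (π ^ v) * s (ℓ - 1 - v) with hH
  let J' : Ideal R[X] := Submodule.comap (LinearMap.mulRight R[X] H) (Ideal.span {g})
  have hJ' : ∀ f, f ∈ J' ↔ g ∣ f * H := fun f => Ideal.mem_span_singleton
  rw [← hJ' f]
  suffices h : J = J' by rw [h]
  apply le_antisymm
  · refine htgen J' fun j hj => (hJ' _).2 ?_
    have := (hcheck (hsm j) (htm j) (by rw [mul_comm]; exact (hs j).symm)
      (v := ℓ - 1 - j) (by omega)).2
    rw [show ℓ - 1 - (ℓ - 1 - j) = j by omega] at this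
    exact this dvd_rfl
  · obtain ⟨t', htm', htg', -, htJ', htgen'⟩ := exists_monic_chain_generating hφ hker hnil hg hsep
      J' ((hJ' g).2 (dvd_mul_right g H))
    refine htgen' J fun j hj => ?_
    obtain ⟨s', hs'⟩ := htg' j
    have hsm' : s'.Monic := (htm' j).of_mul_monic_left (hs' ▸ hg)
    have := (hcheck hsm' (htm' j) (by rw [mul_comm]; exact hs'.symm)
      (v := ℓ - 1 - j) (by omega)).1
    rw [show ℓ - 1 - (ℓ - 1 - j) = j by omega] at this
    obtain ⟨c, hc⟩ := this ((hJ' _).1 (htJ' j))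
    have htt' : t' j = t j * c := by
      refine hsm'.isRegular.right ?_
      simp only
      rw [← hs', hs j, hc]
      ring
    rw [htt', ← mul_assoc]
    exact J.mul_mem_right _ (htJ j)

theorem dvd_of_checkPolynomial (hφ : Function.Surjective φ)
    (hker : RingHom.ker φ = Ideal.span {π}) (hnil : π ^ ℓ = 0)
    (htop : ∀ x, π ^ (ℓ - 1) * x = 0 → φ x = 0) {g : R[X]} (hg : g.Monic)
    (hsep : g.Separable) {h h' : ℕ → R[X]} (hm : ∀ v, (h v).Monic)
    (h0 : h 0 ∣ g) (hchain : ∀ v, v + 1 < ℓ → h (v + 1) ∣ h v)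
    (h0' : h' 0 ∣ g) (hchain' : ∀ v, v + 1 < ℓ → h' (v + 1) ∣ h' v)
    (hann : ∀ f, g ∣ f * ∑ v ∈ Finset.range ℓ, C (π ^ v) * h v →
      g ∣ f * ∑ v ∈ Finset.range ℓ, C (π ^ v) * h' v) {v : ℕ} (hv : v < ℓ) :
    h v ∣ h' v := by
  obtain ⟨d, hd⟩ := (dvd_of_le_of_chain hchain (Nat.zero_le v) hv).trans h0
  have hdm : d.Monic := (hm v).of_mul_monic_left (hd ▸ hg)
  exact (dvd_mul_checkPolynomial_iff hφ hker hnil htop hsep h0' hchain' (hm v) hdm hd.symm hv).1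
    (hann _ ((dvd_mul_checkPolynomial_iff hφ hker hnil htop hsep h0 hchain (hm v) hdm hd.symm
      hv).2 dvd_rfl))

set_option maxHeartbeats 400000 in
theorem existsUnique_checkPolynomial (hφ : Function.Surjective φ)
    (hker : RingHom.ker φ = Ideal.span {π}) (hℓ : 0 < ℓ) (hnil : π ^ ℓ = 0)
    (htop : ∀ x, π ^ (ℓ - 1) * x = 0 → φ x = 0) {g : R[X]} (hg : g.Monic)
    (hsep : g.Separable) (I : Ideal (R[X] ⧸ Ideal.span {g})) :
    ∃! h : Fin ℓ → R[X],
      (∀ v, (h v).Monic) ∧ h ⟨0, hℓ⟩ ∣ g ∧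
      (∀ v : ℕ, ∀ hv : v + 1 < ℓ, h ⟨v + 1, hv⟩ ∣ h ⟨v, Nat.lt_of_succ_lt hv⟩) ∧
      (∀ f : R[X] ⧸ Ideal.span {g}, f ∈ I ↔ f * Ideal.Quotient.mk (Ideal.span {g})
          (∑ v : Fin ℓ, C (π ^ (v : ℕ)) * h v) = 0) := by
  have hmk : ∀ f H : R[X], Ideal.Quotient.mk (Ideal.span {g}) f *
      Ideal.Quotient.mk (Ideal.span {g}) H = 0 ↔ g ∣ f * H := fun f H => by
    rw [← map_mul, Ideal.Quotient.eq_zero_iff_mem, Ideal.mem_span_singleton]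
  obtain ⟨ext, hext, hext'⟩ : ∃ ext : (Fin ℓ → R[X]) → ℕ → R[X],
      (∀ h v (hv : v < ℓ), ext h v = h ⟨v, hv⟩) ∧ ∀ h v, ¬ v < ℓ → ext h v = 1 :=
    ⟨fun h v => if hv : v < ℓ then h ⟨v, hv⟩ else 1, fun _ _ hv => dif_pos hv,
      fun _ _ hv => dif_neg hv⟩
  have hsum : ∀ h, ∑ v : Fin ℓ, C (π ^ (v : ℕ)) * h v =
      ∑ v ∈ Finset.range ℓ, C (π ^ v) * ext h v := fun h => by
    rw [← Fin.sum_univ_eq_sum_range (fun v => C (π ^ v) * ext h v)]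
    exact Finset.sum_congr rfl fun v _ => by rw [hext h v v.2]
  have hextm : ∀ h : Fin ℓ → R[X], (∀ v, (h v).Monic) → ∀ v, (ext h v).Monic := fun h hm v => by
    by_cases hv : v < ℓ
    · rw [hext h v hv]
      exact hm _
    · rw [hext' h v hv]
      exact monic_one
  have huniq : ∀ h h' : Fin ℓ → R[X], (∀ v, (h v).Monic) →
      h ⟨0, hℓ⟩ ∣ g → h' ⟨0, hℓ⟩ ∣ g →
      (∀ v : ℕ, ∀ hv : v + 1 < ℓ, h ⟨v + 1, hv⟩ ∣ h ⟨v, Nat.lt_of_succ_lt hv⟩) →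
      (∀ v : ℕ, ∀ hv : v + 1 < ℓ, h' ⟨v + 1, hv⟩ ∣ h' ⟨v, Nat.lt_of_succ_lt hv⟩) →
      (∀ f : R[X] ⧸ Ideal.span {g}, f ∈ I ↔ f * Ideal.Quotient.mk (Ideal.span {g})
          (∑ v : Fin ℓ, C (π ^ (v : ℕ)) * h v) = 0) →
      (∀ f : R[X] ⧸ Ideal.span {g}, f ∈ I ↔ f * Ideal.Quotient.mk (Ideal.span {g})
          (∑ v : Fin ℓ, C (π ^ (v : ℕ)) * h' v) = 0) → ∀ v, h v ∣ h' v := by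
    intro h h' hm h0 h0' hc hc' hI hI' v
    have := dvd_of_checkPolynomial (h := ext h) (h' := ext h') hφ hker hnil htop hg hsep
      (hextm h hm) (by rwa [hext h 0 hℓ])
      (fun v hv => by rw [hext h _ hv, hext h _ (Nat.lt_of_succ_lt hv)]; exact hc v hv)
      (by rwa [hext h' 0 hℓ])
      (fun v hv => by rw [hext h' _ hv, hext h' _ (Nat.lt_of_succ_lt hv)]; exact hc' v hv)
      (fun f hf => by
        rw [← hsum, ← hmk] at hf ⊢
        exact (hI' _).1 ((hI _).2 hf)) v.2
    rwa [hext h v v.2, hext h' v v.2] at this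
  obtain ⟨h, hm, h0, hc, hI⟩ := exists_checkPolynomial hφ hker hnil htop hg hsep
    (I.comap (Ideal.Quotient.mk (Ideal.span {g}))) (by
      rw [Ideal.mem_comap, Ideal.Quotient.eq_zero_iff_mem.2 (Ideal.mem_span_singleton_self g)]
      exact I.zero_mem)
  have hIh : ∀ f : R[X] ⧸ Ideal.span {g}, f ∈ I ↔ f * Ideal.Quotient.mk (Ideal.span {g})
      (∑ v : Fin ℓ, C (π ^ (v : ℕ)) * h v) = 0 := fun f => by
    obtain ⟨f, rfl⟩ := Ideal.Quotient.mk_surjective f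
    rw [hmk, Fin.sum_univ_eq_sum_range (fun v => C (π ^ v) * h v), ← hI, Ideal.mem_comap]
  refine ⟨fun v => h v, ⟨fun v => hm v, h0, fun v hv => hc v hv, hIh⟩, ?_⟩
  rintro h' ⟨hm', h0', hc', hI'⟩
  funext v
  exact eq_of_monic_of_dvd_dvd (hm' v) (hm v) (huniq h' _ hm' h0' h0 hc' hc hI' hIh v)
    (huniq (fun v => h v) h' (fun v => hm v) h0 h0' hc hc' hIh hI' v)

end Lifting

theorem isLocalRing_of_ideals_total {R : Type*} [CommRing R] [Nontrivial R]
    (hchain : ∀ I J : Ideal R, I ≤ J ∨ J ≤ I) : IsLocalRing R := by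
  obtain ⟨M, hM⟩ := Ideal.exists_maximal R
  refine IsLocalRing.of_unique_max_ideal ⟨M, hM, fun N hN => ?_⟩
  rcases hchain N M with h | h
  · exact hN.eq_of_le hM.ne_top h
  · exact (hM.eq_of_le hN.ne_top h).symm

theorem natCast_ne_zero_of_coprime_of_natCard_eq_pow {k : Type*} [Field k] [Finite k]
    {p r n : ℕ} (hcard : Nat.card k = p ^ r) (hnp : n.Coprime p) : (n : k) ≠ 0 := by
  intro hn
  have hpr : ((p ^ r : ℕ) : k) = 0 := by
    rw [← hcard]
    have := Fintype.ofFinite k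
    rw [Nat.card_eq_fintype_card, Nat.cast_card_eq_zero]
  have hco : IsCoprime ((n : ℤ) : k) (((p ^ r : ℕ) : ℤ) : k) :=
    (Nat.isCoprime_iff_coprime.2 (hnp.pow_right r)).map (Int.castRingHom k)
  rw [Int.cast_natCast, Int.cast_natCast, hn, hpr] at hco
  exact not_isCoprime_zero_zero hco

/-- With the standing setup, any ideal `C` of `𝓡 = R[X]/⟨X^n−λ⟩` has a unique sequence of
monic polynomials `h_0, h_1, …, h_{ℓ−1} ∈ R[X]` with (h1) `h_0 ∣ X^n−λ` and
`h_v ∣ h_{v−1}` for `v = 1,…,ℓ−1`, and (h2) `h_0 + πh_1 + ⋯ + π^{ℓ−1}h_{ℓ−1}` is a check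
polynomial of `C`: for all `f ∈ 𝓡`, `f ∈ C ↔ f·(h_0 + πh_1 + ⋯ + π^{ℓ−1}h_{ℓ−1}) = 0`. -/
theorem stmt_8 {R : Type*} [CommRing R] [Fintype R]
    (hchain : ∀ I J : Ideal R, I ≤ J ∨ J ≤ I)
    (π : R) (hJ : Ideal.jacobson (⊥ : Ideal R) = Ideal.span {π})
    (ℓ : ℕ) (hℓ : 0 < ℓ) (hnil : π ^ ℓ = 0) (hnil' : π ^ (ℓ - 1) ≠ 0)
    (p r : ℕ) (hp : p.Prime) (hcard : Nat.card (R ⧸ Ideal.span {π}) = p ^ r)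
    (n : ℕ) (hn : 1 < n) (hnp : Nat.Coprime n p)
    (lam : R) (hlam : IsUnit lam)
    (I : Ideal (Polynomial R ⧸ Ideal.span {X ^ n - Polynomial.C lam})) :
    ∃! h : Fin ℓ → Polynomial R,
      (∀ v, (h v).Monic) ∧
      h ⟨0, hℓ⟩ ∣ (X ^ n - Polynomial.C lam) ∧
      (∀ v : ℕ, ∀ hv : v + 1 < ℓ, h ⟨v + 1, hv⟩ ∣ h ⟨v, Nat.lt_of_succ_lt hv⟩) ∧
      (∀ f : Polynomial R ⧸ Ideal.span {X ^ n - Polynomial.C lam},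
        f ∈ I ↔ f * Ideal.Quotient.mk (Ideal.span {X ^ n - Polynomial.C lam})
          (∑ v : Fin ℓ, Polynomial.C (π ^ (v : ℕ)) * h v) = 0) := by
  have : Nontrivial R := ⟨⟨_, _, hnil'⟩⟩
  have := isLocalRing_of_ideals_total hchain
  have hmax : (Ideal.span {π}).IsMaximal := by
    rw [← hJ, IsLocalRing.jacobson_eq_maximalIdeal ⊥ bot_ne_top]
    exact IsLocalRing.maximalIdeal.isMaximal R
  let := Ideal.Quotient.field (Ideal.span {π})
  have hunit : ∀ x : R, Ideal.Quotient.mk (Ideal.span {π}) x ≠ 0 → IsUnit x := fun x hx => by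
    rwa [Ne, Ideal.Quotient.eq_zero_iff_mem, ← hJ, IsLocalRing.jacobson_eq_maximalIdeal ⊥ bot_ne_top,
      IsLocalRing.notMem_maximalIdeal] at hx
  have hnunit : IsUnit (n : R) := hunit _ (by
    rw [map_natCast]
    exact natCast_ne_zero_of_coprime_of_natCard_eq_pow hcard hnp)
  refine existsUnique_checkPolynomial (φ := Ideal.Quotient.mk (Ideal.span {π}))
    Ideal.Quotient.mk_surjective Ideal.mk_ker hℓ hnil (fun x hx => ?_)
    (monic_X_pow_sub_C lam (by omega)) ?_ I
  · by_contra hx0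
    exact hnil' ((hunit x hx0).mul_left_eq_zero.1 hx)
  · obtain ⟨u, rfl⟩ := hlam
    exact separable_X_pow_sub_C_unit u hnunit
end

section
/- With the standing setup, let C be a nonzero ideal of 𝓡 = R[X]/⟨X^n−λ⟩ and let 0 ≤ v ≤ ℓ−1. Then C ∩ 𝓡π^v is nonzero and the minimum Hamming weights coincide: w_H(C ∩ 𝓡π^v) = w_H(C). -/
open Polynomial

/-- The Hamming weight of an element of `S[X]/⟨g⟩` (`g` monic of degree `n`): the number of
nonzero coefficients of its unique representative of degree `< n`. -/
noncomputable def hammingWt {S : Type*} [CommRing S] (g : Polynomial S)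
    (c : Polynomial S ⧸ Ideal.span {g}) : ℕ :=
  ((Quotient.out c) %ₘ g).support.card

/-- The minimum Hamming weight of an ideal (code) `I ⊆ S[X]/⟨g⟩`: the least Hamming weight
of a nonzero element of `I`. -/
noncomputable def minWt {S : Type*} [CommRing S] (g : Polynomial S)
    (I : Ideal (Polynomial S ⧸ Ideal.span {g})) : ℕ :=
  sInf {k | ∃ c ∈ I, c ≠ 0 ∧ hammingWt g c = k}

theorem mk_eq_mk_iff_modByMonic_eq {S : Type*} [CommRing S] {g : Polynomial S} (hg : g.Monic)
    (f h : Polynomial S) :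
    Ideal.Quotient.mk (Ideal.span {g}) f = Ideal.Quotient.mk (Ideal.span {g}) h ↔
      f %ₘ g = h %ₘ g := by
  rw [Ideal.Quotient.eq, Ideal.mem_span_singleton, ← modByMonic_eq_zero_iff_dvd hg,
    sub_modByMonic, sub_eq_zero]

theorem hammingWt_mk {S : Type*} [CommRing S] {g : Polynomial S} (hg : g.Monic)
    (f : Polynomial S) :
    hammingWt g (Ideal.Quotient.mk (Ideal.span {g}) f) = (f %ₘ g).support.card := by
  unfold hammingWt
  rw [(mk_eq_mk_iff_modByMonic_eq hg _ f).1 (Quotient.out_eq _)]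

/-- In a chain ring with Jacobson radical `(π)`, the annihilator of `π` is contained in `(π ^ k)`
whenever `π ^ k ≠ 0`. -/
theorem pow_dvd_of_mul_eq_zero {R : Type*} [CommRing R]
    (hchain : ∀ I J : Ideal R, I ≤ J ∨ J ≤ I) {π : R}
    (hJ : Ideal.jacobson (⊥ : Ideal R) = Ideal.span {π}) {k : ℕ} (hk : π ^ k ≠ 0)
    {a : R} (ha : π * a = 0) : π ^ k ∣ a := by
  have : Nontrivial R := ⟨_, _, hk⟩
  have hlocal : IsLocalRing R := IsLocalRing.of_nonunits_add fun x y hx hy => by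
    rcases hchain (Ideal.span {x}) (Ideal.span {y}) with h | h <;>
      rw [Ideal.span_singleton_le_span_singleton] at h
    · exact mt (isUnit_of_dvd_unit (dvd_add h dvd_rfl)) hy
    · exact mt (isUnit_of_dvd_unit (dvd_add dvd_rfl h)) hx
  rcases hchain (Ideal.span {a}) (Ideal.span {π ^ k}) with h | h <;>
    rw [Ideal.span_singleton_le_span_singleton] at h
  · exact h
  · obtain ⟨b, hb⟩ := h
    by_cases hu : IsUnit b
    · obtain ⟨u, rfl⟩ := hu
      exact ⟨↑u⁻¹, by rw [hb, mul_assoc, Units.mul_inv, mul_one]⟩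
    · have hmem : b ∈ Ideal.span {π} := by
        rw [← hJ, IsLocalRing.jacobson_eq_maximalIdeal ⊥ bot_ne_top]
        exact hu
      obtain ⟨e, rfl⟩ := Ideal.mem_span_singleton.1 hmem
      exact absurd (by rw [hb]; linear_combination e * ha) hk

/-- Multiplying by a suitable power of `π` moves a nonzero codeword to a nonzero multiple of
`π ^ k` without increasing the weight. -/
theorem exists_mem_span_pow_hammingWt_le {R : Type*} [CommRing R]
    (hchain : ∀ I J : Ideal R, I ≤ J ∨ J ≤ I) {π : R}
    (hJ : Ideal.jacobson (⊥ : Ideal R) = Ideal.span {π}) {k l : ℕ} (hk : π ^ k ≠ 0)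
    (hl : π ^ l = 0) {g : Polynomial R} (hg : g.Monic)
    (I : Ideal (Polynomial R ⧸ Ideal.span {g})) {c : Polynomial R ⧸ Ideal.span {g}}
    (hc : c ∈ I) (hc0 : c ≠ 0) :
    ∃ d ∈ I ⊓ Ideal.span {Ideal.Quotient.mk (Ideal.span {g}) (Polynomial.C (π ^ k))},
      d ≠ 0 ∧ hammingWt g d ≤ hammingWt g c := by
  classical
  obtain ⟨f, rfl⟩ := Ideal.Quotient.mk_surjective c
  have hmod (a : R) : (Polynomial.C a * f) %ₘ g = Polynomial.C a * (f %ₘ g) := by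
    rw [← smul_eq_C_mul, smul_modByMonic, smul_eq_C_mul]
  have hzero (h : Polynomial R) :
      Ideal.Quotient.mk (Ideal.span {g}) h = 0 ↔ h %ₘ g = 0 := by
    rw [← map_zero (Ideal.Quotient.mk (Ideal.span {g})), mk_eq_mk_iff_modByMonic_eq hg,
      zero_modByMonic]
  have hex : ∃ m, Polynomial.C (π ^ m) * (f %ₘ g) = 0 := ⟨l, by simp [hl]⟩
  obtain ⟨m, hm⟩ : ∃ m, Nat.find hex = m + 1 := Nat.exists_eq_succ_of_ne_zero fun h0 => by
    have := Nat.find_spec hex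
    rw [h0] at this
    exact hc0 ((hzero f).2 (by simpa using this))
  have hm0 : Polynomial.C (π ^ m) * (f %ₘ g) ≠ 0 := Nat.find_min hex (by lia)
  have hm1 : Polynomial.C (π ^ (m + 1)) * (f %ₘ g) = 0 := hm ▸ Nat.find_spec hex
  refine ⟨Ideal.Quotient.mk _ (Polynomial.C (π ^ m) * f), ⟨?_, ?_⟩, ?_, ?_⟩
  · rw [map_mul]
    exact I.mul_mem_left _ hc
  · have hdvd : Polynomial.C (π ^ k) ∣ Polynomial.C (π ^ m) * (f %ₘ g) := by
      refine (C_dvd_iff_dvd_coeff _ _).2 fun i => pow_dvd_of_mul_eq_zero hchain hJ hk ?_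
      have := congrArg (fun q => coeff q i) hm1
      rw [coeff_C_mul, ← mul_assoc, ← pow_succ']
      simpa only [coeff_C_mul, coeff_zero] using this
    have heq : Ideal.Quotient.mk (Ideal.span {g}) (f %ₘ g) = Ideal.Quotient.mk _ f := by
      rw [Ideal.Quotient.eq, Ideal.mem_span_singleton, modByMonic_eq_sub_mul_div f g]
      exact ⟨-(f /ₘ g), by ring⟩
    rw [map_mul, ← heq, ← map_mul]
    exact Ideal.mem_span_singleton.2 (map_dvd _ hdvd)
  · rwa [Ne, hzero, hmod]
  · rw [hammingWt_mk hg, hammingWt_mk hg, hmod]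
    refine Finset.card_le_card fun i hi => ?_
    rw [mem_support_iff, coeff_C_mul] at hi
    exact mem_support_iff.2 (right_ne_zero_of_mul hi)

theorem minWt_eq_of_le {S : Type*} [CommRing S] (g : Polynomial S)
    {I J : Ideal (Polynomial S ⧸ Ideal.span {g})} (hle : J ≤ I) (hI : I ≠ ⊥)
    (h : ∀ c ∈ I, c ≠ 0 → ∃ d ∈ J, d ≠ 0 ∧ hammingWt g d ≤ hammingWt g c) :
    J ≠ ⊥ ∧ minWt g J = minWt g I := by
  obtain ⟨c, hc, hc0⟩ := Submodule.exists_mem_ne_zero_of_ne_bot hI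
  obtain ⟨d, hd, hd0, -⟩ := h c hc hc0
  refine ⟨fun hJ => hd0 (by simpa [hJ] using hd), le_antisymm ?_ ?_⟩
  · obtain ⟨x, hx, hx0, hxw⟩ := Nat.sInf_mem
      (s := {k | ∃ c ∈ I, c ≠ 0 ∧ hammingWt g c = k}) ⟨_, c, hc, hc0, rfl⟩
    obtain ⟨y, hy, hy0, hyw⟩ := h x hx hx0
    have hle_y : minWt g J ≤ hammingWt g y := Nat.sInf_le ⟨y, hy, hy0, rfl⟩
    exact hle_y.trans (hyw.trans_eq hxw)
  · obtain ⟨x, hx, hx0, hxw⟩ := Nat.sInf_mem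
      (s := {k | ∃ c ∈ J, c ≠ 0 ∧ hammingWt g c = k}) ⟨_, d, hd, hd0, rfl⟩
    exact Nat.sInf_le (s := {k | ∃ c ∈ I, c ≠ 0 ∧ hammingWt g c = k})
      ⟨x, hle hx, hx0, hxw⟩

/-- With the standing setup, for a nonzero ideal `C` of `𝓡 = R[X]/⟨X^n−λ⟩` and
`0 ≤ v ≤ ℓ−1`, the ideal `C ∩ 𝓡π^v` is nonzero and `w_H(C ∩ 𝓡π^v) = w_H(C)`. -/
theorem stmt_10 {R : Type*} [CommRing R] [Fintype R]
    (hchain : ∀ I J : Ideal R, I ≤ J ∨ J ≤ I)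
    (π : R) (hJ : Ideal.jacobson (⊥ : Ideal R) = Ideal.span {π})
    (ℓ : ℕ) (hℓ : 0 < ℓ) (hnil : π ^ ℓ = 0) (hnil' : π ^ (ℓ - 1) ≠ 0)
    (p r : ℕ) (hp : p.Prime) (hcard : Nat.card (R ⧸ Ideal.span {π}) = p ^ r)
    (n : ℕ) (hn : 1 < n) (hnp : Nat.Coprime n p)
    (lam : R) (hlam : IsUnit lam)
    (I : Ideal (Polynomial R ⧸ Ideal.span {X ^ n - Polynomial.C lam})) (hI : I ≠ ⊥)
    (v : ℕ) (hv : v ≤ ℓ - 1) :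
    I ⊓ Ideal.span {Ideal.Quotient.mk (Ideal.span {X ^ n - Polynomial.C lam})
        (Polynomial.C (π ^ v))} ≠ ⊥ ∧
    minWt (X ^ n - Polynomial.C lam)
        (I ⊓ Ideal.span {Ideal.Quotient.mk (Ideal.span {X ^ n - Polynomial.C lam})
          (Polynomial.C (π ^ v))}) =
      minWt (X ^ n - Polynomial.C lam) I := by
  have hv0 : π ^ v ≠ 0 := fun h => hnil' (pow_eq_zero_of_le hv h)
  have hg : (X ^ n - Polynomial.C lam).Monic := monic_X_pow_sub_C lam (by lia)
  exact minWt_eq_of_le _ inf_le_left hI fun c hc hc0 =>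
    exists_mem_span_pow_hammingWt_le hchain hJ hv0 hnil hg I hc hc0
end

section
/- Let R be a finite commutative principal ideal ring, let λ be a unit of R, and let n > 1 be an integer with gcd(n, char R) = 1, where char R is the characteristic of R. Then the quotient ring R[X]/⟨X^n−λ⟩ is a finite principal ideal ring. -/
open Polynomial

/-- In a finite monoid every element has a positive power that is idempotent. -/
theorem exists_pow_isIdempotentElem_of_finite {M : Type*} [Monoid M] [Finite M] (x : M) :
    ∃ m : ℕ, m ≠ 0 ∧ IsIdempotentElem (x ^ m) := by
  obtain ⟨i, j, hij, h⟩ : ∃ i j : ℕ, i < j ∧ x ^ i = x ^ j := by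
    obtain ⟨i, j, h, hne⟩ := Function.not_injective_iff.mp
      (not_injective_infinite_finite fun k : ℕ ↦ x ^ k)
    rcases hne.lt_or_gt with hlt | hlt
    exacts [⟨i, j, hlt, h⟩, ⟨j, i, hlt, h.symm⟩]
  obtain ⟨d, hd, rfl⟩ : ∃ d, d ≠ 0 ∧ j = i + d := ⟨j - i, by omega, by omega⟩
  have hstep (k : ℕ) (hk : i ≤ k) (t : ℕ) : x ^ (k + t * d) = x ^ k := by
    induction t with
    | zero => simp
    | succ t ih =>
      obtain ⟨l, rfl⟩ := Nat.exists_eq_add_of_le' hk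
      rw [← ih, show l + i + (t + 1) * d = l + t * d + (i + d) by ring, pow_add, ← h, ← pow_add]
      congr 1
      ring
  refine ⟨(i + 1) * d, by positivity, ?_⟩
  rw [IsIdempotentElem, ← pow_add]
  exact hstep _ (by nlinarith [Nat.pos_of_ne_zero hd]) _

/-- The ideal generated by an idempotent and one further element is principal. -/
theorem IsIdempotentElem.isPrincipal_span_pair {S : Type*} [CommRing S] {e : S}
    (he : IsIdempotentElem e) (a : S) : (Ideal.span {a, e}).IsPrincipal := by
  have he' : e * e = e := he
  refine ⟨e + (1 - e) * a, le_antisymm ?_ ?_⟩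
  · rw [Ideal.span_le, Set.pair_subset_iff]
    constructor
    · exact Ideal.mem_span_singleton'.mpr ⟨e * a + 1 - e, by grind⟩
    · exact Ideal.mem_span_singleton'.mpr ⟨e, by grind⟩
  · rw [Ideal.submodule_span_eq, Ideal.span_singleton_le_iff_mem]
    exact Ideal.mem_span_pair.mpr ⟨1 - e, 1, by ring⟩

/-- In a finite ring, an ideal containing an element that generates the kernel of a surjection
onto a reduced ring is principal. -/
theorem Ideal.isPrincipal_of_ker_eq_span_of_isReduced {S T : Type*} [CommRing S] [Finite S]
    [CommRing T] [IsReduced T] (f : S →+* T) (hf : Function.Surjective f) {a : S}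
    (hker : RingHom.ker f = Ideal.span {a}) {P : Ideal S} (ha : a ∈ P) : P.IsPrincipal := by
  have : Finite T := Finite.of_surjective f hf
  have : IsSemisimpleRing T := IsArtinianRing.isSemisimpleRing_of_isReduced T
  obtain ⟨c', hc'⟩ := (IsPrincipalIdealRing.principal (P.map f)).principal
  rw [Ideal.submodule_span_eq] at hc'
  obtain ⟨c, hcP, rfl⟩ := (Ideal.mem_map_iff_of_surjective f hf).mp
    (hc' ▸ Ideal.mem_span_singleton_self c')
  obtain ⟨m, hm, he⟩ := exists_pow_isIdempotentElem_of_finite c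
  have hfe : f c ^ m * f c ^ m = f c ^ m := by simpa using congrArg f he.eq
  have hc : f c * (1 - f c ^ m) = 0 := by
    refine IsReduced.eq_zero _ ⟨m, ?_⟩
    obtain ⟨k, rfl⟩ := Nat.exists_eq_succ_of_ne_zero hm
    rw [mul_pow, pow_succ (1 - _), mul_left_comm, mul_one_sub, hfe, sub_self, mul_zero]
  suffices P = Ideal.span {a, c ^ m} from this ▸ he.isPrincipal_span_pair a
  refine le_antisymm (fun x hx ↦ ?_) ?_
  · obtain ⟨y', hy'⟩ := Ideal.mem_span_singleton'.mp (hc' ▸ Ideal.mem_map_of_mem f hx)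
    obtain ⟨y, rfl⟩ := hf y'
    have hx' : x - y * c * c ^ m ∈ RingHom.ker f := by
      rw [RingHom.mem_ker, map_sub, map_mul, map_mul, map_pow, ← hy']
      linear_combination f y * hc
    obtain ⟨z, hz⟩ := Ideal.mem_span_singleton'.mp (hker ▸ hx')
    exact Ideal.mem_span_pair.mpr ⟨z, y * c, by rw [hz]; ring⟩
  · rw [Ideal.span_le, Set.pair_subset_iff]
    exact ⟨ha, P.pow_mem_of_mem hcP m (Nat.pos_of_ne_zero hm)⟩

/-- The kernel of `R[X] ⧸ (g) → k[X] ⧸ (g)` induced by a surjection `R → k` whose kernel is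
generated by `a` is generated by `a`. -/
theorem Polynomial.ker_quotientMap_eq_span {R k : Type*} [CommRing R] [CommRing k] (f : R →+* k)
    (hf : Function.Surjective f) {a : R} (hker : RingHom.ker f = Ideal.span {a}) (g : R[X])
    (hg : Ideal.span {g} ≤ (Ideal.span {g.map f}).comap (mapRingHom f)) :
    RingHom.ker (Ideal.quotientMap (Ideal.span {g.map f}) (mapRingHom f) hg) =
      Ideal.span {Ideal.Quotient.mk _ (C a)} := by
  have hfa : f a = 0 := RingHom.mem_ker.mp (hker ▸ Ideal.mem_span_singleton_self a)
  refine le_antisymm (fun x hx ↦ ?_) ?_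
  · obtain ⟨p, rfl⟩ := Ideal.Quotient.mk_surjective x
    rw [RingHom.mem_ker, Ideal.quotientMap_mk, Ideal.Quotient.eq_zero_iff_mem] at hx
    obtain ⟨h', hh'⟩ := Ideal.mem_span_singleton'.mp hx
    obtain ⟨h, rfl⟩ := map_surjective f hf h'
    have hp : p - h * g ∈ RingHom.ker (mapRingHom f) := by
      rw [RingHom.mem_ker, map_sub, ← hh']
      simp
    rw [ker_mapRingHom, hker, Ideal.map_span, Set.image_singleton] at hp
    obtain ⟨q, hq⟩ := Ideal.mem_span_singleton'.mp hp
    refine Ideal.mem_span_singleton'.mpr ⟨Ideal.Quotient.mk _ q, ?_⟩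
    rw [← map_mul, hq, Ideal.Quotient.mk_eq_mk_iff_sub_mem]
    exact Ideal.mem_span_singleton'.mpr ⟨-h, by ring⟩
  · rw [Ideal.span_singleton_le_iff_mem, RingHom.mem_ker, Ideal.quotientMap_mk]
    simp [hfa]

/-- Over a finite principal ideal ring, the quotient of the polynomial ring by a monic separable
polynomial is a principal ideal ring. -/
theorem Polynomial.Separable.isPrincipalIdealRing_quotient {R : Type*} [CommRing R] [Finite R]
    [IsPrincipalIdealRing R] {g : R[X]} (hsep : g.Separable) [Finite (R[X] ⧸ Ideal.span {g})] :
    IsPrincipalIdealRing (R[X] ⧸ Ideal.span {g}) := by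
  refine IsPrincipalIdealRing.of_prime fun P hP ↦ ?_
  let p : Ideal R := P.comap ((Ideal.Quotient.mk (Ideal.span {g})).comp C)
  have hp : p.IsPrime := Ideal.comap_isPrime _ _
  have hpmax : p.IsMaximal := Ideal.IsPrime.isMaximal' hp
  let : Field (R ⧸ p) := Ideal.Quotient.field p
  obtain ⟨a, ha⟩ := (IsPrincipalIdealRing.principal p).principal
  have hf := Ideal.Quotient.mk_surjective (I := p)
  have hrad : IsRadical (g.map (Ideal.Quotient.mk p)) := hsep.map.squarefree.isRadical
  have : IsReduced ((R ⧸ p)[X] ⧸ Ideal.span {g.map (Ideal.Quotient.mk p)}) :=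
    (Ideal.isRadical_iff_quotient_reduced _).mp (isRadical_iff_span_singleton.mp hrad)
  have hle : Ideal.span {g} ≤
      (Ideal.span {g.map (Ideal.Quotient.mk p)}).comap (mapRingHom (Ideal.Quotient.mk p)) := by
    rw [Ideal.span_singleton_le_iff_mem]
    exact Ideal.mem_span_singleton_self _
  have hap : a ∈ p := ha ▸ Ideal.mem_span_singleton_self a
  exact Ideal.isPrincipal_of_ker_eq_span_of_isReduced _
    (Ideal.quotientMap_surjective (H := hle) (map_surjective _ hf))
    (ker_quotientMap_eq_span _ hf (by rw [Ideal.mk_ker, ha]) g hle) hap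

/-- A natural number coprime to the characteristic of a ring is a unit in that ring. -/
theorem isUnit_natCast_of_coprime_ringChar {R : Type*} [CommRing R] {n : ℕ}
    (h : n.Coprime (ringChar R)) : IsUnit (n : R) := by
  obtain ⟨u, v, huv⟩ := Nat.isCoprime_iff_coprime.mpr h
  refine IsUnit.of_mul_eq_one (u : R) ?_
  simpa [mul_comm] using congrArg (Int.cast : ℤ → R) huv

/-- Let `R` be a finite commutative principal ideal ring, `λ` a unit of `R`, and `n > 1`
an integer with `gcd(n, char R) = 1`.  Then `R[X]/⟨X^n−λ⟩` is a finite principal ideal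
ring. -/
theorem stmt_13 {R : Type*} [CommRing R] [Fintype R] [IsPrincipalIdealRing R]
    (lam : R) (hlam : IsUnit lam)
    (n : ℕ) (hn : 1 < n) (hcop : Nat.Coprime n (ringChar R)) :
    Finite (Polynomial R ⧸ Ideal.span {X ^ n - Polynomial.C lam}) ∧
    IsPrincipalIdealRing (Polynomial R ⧸ Ideal.span {X ^ n - Polynomial.C lam}) := by
  have hmonic : (X ^ n - C lam).Monic := monic_X_pow_sub_C lam (by omega)
  have := hmonic.finite_quotient
  have : Finite (R[X] ⧸ Ideal.span {X ^ n - C lam}) := Module.finite_of_finite R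
  have hsep : (X ^ n - C lam).Separable :=
    separable_X_pow_sub_C_unit hlam.unit (isUnit_natCast_of_coprime_ringChar hcop)
  exact ⟨this, hsep.isPrincipalIdealRing_quotient⟩
end

section
/- Let R = R_1 ⊕ ⋯ ⊕ R_m be a finite commutative principal ideal ring, where each R_i is a finite chain ring whose Jacobson radical J(R_i) has nilpotency index ℓ_i, and let λ be a unit of R and n > 1 an integer. If min{ℓ_i, gcd(n, char R_i)} = 1 for every i = 1, …, m (i.e. for each i, either R_i is a field or n is coprime to char R_i), then R[X]/⟨X^n−λ⟩ is a principal ideal ring; equivalently, every λ-constacyclic code of length n over R is a principal ideal. -/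
open Polynomial

/-- In an Artinian ring, if every prime `P` is generated by one element modulo `P ^ 2`, then every
ideal is principal. -/
theorem IsPrincipalIdealRing.of_prime_le_span_sup_sq {A : Type*} [CommRing A] [IsArtinianRing A]
    (H : ∀ P : Ideal A, P.IsPrime → ∃ y ∈ P, P ≤ Ideal.span {y} ⊔ P * P) :
    IsPrincipalIdealRing A := by
  refine IsPrincipalIdealRing.of_prime fun P hP => ?_
  obtain ⟨y, hyP, hy⟩ := H P hP
  have hpow : ∀ k : ℕ, P ≤ Ideal.span {y} ⊔ P ^ (k + 1) := by
    intro k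
    induction k with
    | zero => simp
    | succ k ih =>
      refine hy.trans (sup_le le_sup_left ?_)
      calc P * P ≤ (Ideal.span {y} ⊔ P ^ (k + 1)) * P := Ideal.mul_mono_left ih
        _ = Ideal.span {y} * P ⊔ P ^ (k + 1 + 1) := by rw [Ideal.sup_mul, pow_succ P (k + 1)]
        _ ≤ _ := sup_le_sup_right Ideal.mul_le_left _
  obtain ⟨N, hN⟩ := IsArtinian.monotone_stabilizes (R := A) (M := A)
    ⟨fun k => OrderDual.toDual (P ^ k), fun a b hab => Ideal.pow_le_pow_right hab⟩
  replace hN : ∀ m, N ≤ m → P ^ N = P ^ m := hN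
  have hidem : IsIdempotentElem (P ^ (N + 1)) := by
    rw [IsIdempotentElem, ← pow_add, ← hN (N + 1) (by omega), ← hN _ (by omega)]
  obtain ⟨e, he, hPe⟩ := (Ideal.isIdempotentElem_iff_of_fg _ (IsNoetherian.noetherian _)).1 hidem
  have hPe' : P ^ (N + 1) = Ideal.span {e} := hPe
  have heP : e ∈ P := Ideal.pow_le_self (Nat.succ_ne_zero N)
    (hPe' ▸ Ideal.mem_span_singleton_self e)
  have hee : e * e = e := he
  refine ⟨e + (1 - e) * y, le_antisymm ((hpow N).trans (sup_le ?_ ?_)) ?_⟩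
  · rw [Ideal.span_singleton_le_iff_mem]
    refine Ideal.mem_span_singleton'.2 ⟨e * y + (1 - e), ?_⟩
    linear_combination (-1 + 2 * y - y ^ 2) * hee
  · rw [hPe', Ideal.span_singleton_le_iff_mem]
    exact Ideal.mem_span_singleton'.2 ⟨e, by linear_combination (1 - y) * hee⟩
  · refine (Ideal.span_singleton_le_iff_mem (I := P)).2 ?_
    exact P.add_mem heP (P.mul_mem_left _ hyP)

/-- A prime of `R[X]` lying over a maximal ideal `(g)` is generated by `g` and one polynomial. -/
theorem Polynomial.exists_le_span_pair_of_isMaximal_comap_C {R : Type*} [CommRing R]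
    (Q : Ideal R[X]) {g : R} (hM : (Q.comap C).IsMaximal) (hg : Q.comap C = Ideal.span {g}) :
    ∃ h ∈ Q, Q ≤ Ideal.span {C g, h} := by
  let M := Q.comap (C : R →+* R[X])
  let _ : Field (R ⧸ M) := Ideal.Quotient.field M
  let φ := Polynomial.mapRingHom (Ideal.Quotient.mk M)
  have hφ : Function.Surjective φ := Polynomial.map_surjective _ Ideal.Quotient.mk_surjective
  have hker : RingHom.ker φ = Ideal.span {C g} := by
    rw [Polynomial.ker_mapRingHom, Ideal.mk_ker, show M = Ideal.span {g} from hg, Ideal.map_span,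
      Set.image_singleton]
  have hgQ : C g ∈ Q := by
    have : g ∈ Q.comap C := hg ▸ Ideal.mem_span_singleton_self g
    exact this
  obtain ⟨hb, hhb⟩ := (IsPrincipalIdealRing.principal (Q.map φ)).principal
  obtain ⟨h, rfl⟩ := hφ hb
  refine ⟨h, ?_, fun q hq => ?_⟩
  · have h1 : h ∈ (Q.map φ).comap φ := by
      rw [Ideal.mem_comap, hhb]
      exact Ideal.mem_span_singleton_self _
    rw [Ideal.comap_map_of_surjective' φ hφ, hker] at h1
    exact sup_le le_rfl ((Ideal.span_singleton_le_iff_mem _).2 hgQ) h1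
  · have h1 : φ q ∈ Ideal.span {φ h} := by
      have := Ideal.mem_map_of_mem φ hq
      rwa [hhb] at this
    obtain ⟨w, hw⟩ := Ideal.mem_span_singleton'.1 h1
    obtain ⟨w, rfl⟩ := hφ w
    have h2 : q - w * h ∈ RingHom.ker φ := by
      rw [RingHom.mem_ker, map_sub, map_mul, hw, sub_self]
    rw [hker] at h2
    obtain ⟨a, ha⟩ := Ideal.mem_span_singleton'.1 h2
    exact Ideal.mem_span_pair.2 ⟨a, w, by linear_combination ha⟩

/-- Over a finite principal ideal ring, the quotient by `X ^ n - λ` with `λ` a unit is a principal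
ideal ring as soon as every prime either is an idempotent ideal or does not contain `n`. -/
theorem Polynomial.isPrincipalIdealRing_quotient_X_pow_sub_C {R : Type*} [CommRing R] [Finite R]
    [IsPrincipalIdealRing R] {n : ℕ} (hn : n ≠ 0) {u : R} (hu : IsUnit u)
    (H : ∀ M : Ideal R, M.IsPrime → M ≤ M * M ∨ (n : R) ∉ M) :
    IsPrincipalIdealRing (R[X] ⧸ Ideal.span {(X ^ n - C u : R[X])}) := by
  set f : R[X] := X ^ n - C u with hf
  have hmonic : f.Monic := monic_X_pow_sub_C u hn
  have := hmonic.finite_quotient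
  have : IsArtinianRing (R[X] ⧸ Ideal.span {f}) := IsArtinianRing.of_finite R _
  refine IsPrincipalIdealRing.of_prime_le_span_sup_sq fun P hP => ?_
  let mk := Ideal.Quotient.mk (Ideal.span {f})
  have hmk : Function.Surjective mk := Ideal.Quotient.mk_surjective
  have hPmax : P.IsMaximal := inferInstance
  let Q := P.comap mk
  have hQmax : Q.IsMaximal := Ideal.comap_isMaximal_of_surjective mk hmk
  have hfmk : mk f = 0 := Ideal.Quotient.eq_zero_iff_mem.2 (Ideal.mem_span_singleton_self f)
  have hfQ : f ∈ Q := by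
    rw [Ideal.mem_comap, hfmk]
    exact P.zero_mem
  have hMprime : (Q.comap (C : R →+* R[X])).IsPrime := inferInstance
  have hMmax : (Q.comap (C : R →+* R[X])).IsMaximal := inferInstance
  obtain ⟨g, hg⟩ := (IsPrincipalIdealRing.principal (Q.comap (C : R →+* R[X]))).principal
  obtain ⟨h, hhQ, hQ⟩ := Polynomial.exists_le_span_pair_of_isMaximal_comap_C Q hMmax hg
  have hgM : g ∈ Q.comap (C : R →+* R[X]) := hg ▸ Ideal.mem_span_singleton_self g
  have hgQ : C g ∈ Q := hgM
  have hPspan : P ≤ Ideal.span {mk (C g), mk h} := by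
    rw [← Ideal.map_comap_of_surjective mk hmk P, ← Set.image_pair, ← Ideal.map_span]
    exact Ideal.map_mono hQ
  rcases H _ hMprime with hM | hnM
  · refine ⟨mk h, hhQ, hPspan.trans (Ideal.span_le.2 ?_)⟩
    rintro x (rfl | rfl)
    · have h1 : mk (C g) ∈ ((Q.comap (C : R →+* R[X])) *
        (Q.comap (C : R →+* R[X]))).map (mk.comp C) := Ideal.mem_map_of_mem (mk.comp C) (hM hgM)
      rw [Ideal.map_mul] at h1
      have h2 : (Q.comap (C : R →+* R[X])).map (mk.comp C) ≤ P :=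
        Ideal.map_le_iff_le_comap.2 fun x hx => hx
      exact le_sup_right (a := Ideal.span {mk h}) (Ideal.mul_mono h2 h2 h1)
    · exact le_sup_left (b := P * P) (Ideal.mem_span_singleton_self _)
  · refine ⟨mk (C g), hgQ, hPspan.trans (Ideal.span_le.2 ?_)⟩
    rintro x (rfl | rfl)
    · exact le_sup_left (b := P * P) (Ideal.mem_span_singleton_self _)
    have hXQ : (X : R[X]) ∉ Q := fun hX => hQmax.ne_top <|
      Q.eq_top_of_isUnit_mem (x := C u) (by
        have := Q.sub_mem (Q.pow_mem_of_mem hX n (Nat.pos_of_ne_zero hn)) hfQ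
        rwa [hf, sub_sub_cancel] at this) (hu.map C)
    have hder : derivative f ∉ Q := by
      intro hd
      rw [hf, derivative_sub, derivative_C, sub_zero, derivative_X_pow] at hd
      rcases hQmax.isPrime.mem_or_mem hd with hd | hd
      · exact hnM hd
      · exact hXQ (hQmax.isPrime.mem_of_pow_mem _ hd)
    obtain ⟨t, k, htk⟩ := Ideal.mem_span_pair.1 (hQ hfQ)
    have hkQ : k ∉ Q := by
      intro hk
      apply hder
      rw [← htk]
      simp only [derivative_add, derivative_mul, derivative_C, mul_zero, add_zero]
      exact Q.add_mem (Q.mul_mem_left _ hgQ)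
        (Q.add_mem (Q.mul_mem_left _ hhQ) (Q.mul_mem_right _ hk))
    obtain ⟨v, hv⟩ := hQmax.exists_inv hkQ
    obtain ⟨q, hqQ, hvq⟩ := hv
    have hkey : mk h = -(mk v * mk t) * mk (C g) + mk q * mk h := by
      have h1 : h = v * f + (-(v * t) * C g + q * h) := by
        rw [← htk]
        linear_combination -h * hvq
      have h2 := congrArg mk h1
      rw [map_add, map_add, map_mul, map_mul, map_mul, hfmk, mul_zero, zero_add, map_neg,
        map_mul] at h2
      exact h2
    rw [SetLike.mem_coe, hkey]
    exact Submodule.add_mem_sup (Ideal.mul_mem_left _ _ (Ideal.mem_span_singleton_self _))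
      (Ideal.mul_mem_mul hqQ hhQ)

/-- In a ring with totally ordered ideals, a nonunit lies in the Jacobson radical. -/
theorem Ideal.mem_jacobson_bot_of_not_isUnit {A : Type*} [CommRing A]
    (hchain : ∀ I J : Ideal A, I ≤ J ∨ J ≤ I) {x : A} (hx : ¬ IsUnit x) :
    x ∈ Ideal.jacobson (⊥ : Ideal A) := by
  obtain ⟨m, hm, hxm⟩ := exists_max_ideal_of_mem_nonunits hx
  refine Ideal.mem_sInf.2 fun {m'} hm' => ?_
  rcases hchain m m' with hle | hle
  · exact hle hxm
  · rwa [hm'.2.eq_of_le hm.ne_top hle]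

/-- A Noetherian ring with totally ordered ideals is a principal ideal ring. -/
theorem IsPrincipalIdealRing.of_ideal_le_total {A : Type*} [CommRing A] [IsNoetherianRing A]
    (hchain : ∀ I J : Ideal A, I ≤ J ∨ J ≤ I) : IsPrincipalIdealRing A := by
  have : IsBezout A := IsBezout.iff_span_pair_isPrincipal.2 fun x y => by
    rw [Ideal.span_insert]
    rcases hchain (Ideal.span {x}) (Ideal.span {y}) with hle | hle
    · rw [sup_eq_right.2 hle]
      exact ⟨y, rfl⟩
    · rw [sup_eq_left.2 hle]
      exact ⟨x, rfl⟩
  infer_instance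

/-- A prime ideal of a finite product of rings omits one of the standard idempotents. -/
theorem Ideal.IsPrime.exists_single_one_notMem {ι : Type*} [Fintype ι] [DecidableEq ι]
    {Rf : ι → Type*} [∀ i, CommRing (Rf i)] {M : Ideal (∀ i, Rf i)} (hM : M.IsPrime) :
    ∃ i, (Pi.single i 1 : ∀ i, Rf i) ∉ M := by
  by_contra! hall
  refine hM.ne_top ((Ideal.eq_top_iff_one M).2 ?_)
  rw [← Finset.univ_sum_single (1 : ∀ i, Rf i)]
  exact M.sum_mem fun i _ => hall i

/-- Let `R = R_1 ⊕ ⋯ ⊕ R_m` be a finite commutative principal ideal ring, a product of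
finite chain rings `R_i` with radical `J(R_i) = R_iπ_i` of nilpotency index `ℓ_i`, let `λ`
be a unit of `R` and `n > 1`.  If `min{ℓ_i, gcd(n, char R_i)} = 1` for every `i` (i.e. each
`R_i` is a field or `n` is coprime to `char R_i`), then `R[X]/⟨X^n−λ⟩` is a principal ideal
ring (every `λ`-constacyclic code of length `n` over `R` is principal). -/
theorem stmt_15 {ι : Type*} [Fintype ι] (Rf : ι → Type*)
    [∀ i, CommRing (Rf i)] [∀ i, Fintype (Rf i)]
    (hchain : ∀ i, ∀ I J : Ideal (Rf i), I ≤ J ∨ J ≤ I)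
    (π : ∀ i, Rf i)
    (hJ : ∀ i, Ideal.jacobson (⊥ : Ideal (Rf i)) = Ideal.span {π i})
    (ℓ : ι → ℕ) (hℓ : ∀ i, 0 < ℓ i)
    (hnil : ∀ i, (π i) ^ (ℓ i) = 0) (hnil' : ∀ i, (π i) ^ (ℓ i - 1) ≠ 0)
    (lam : ∀ i, Rf i) (hlam : ∀ i, IsUnit (lam i))
    (n : ℕ) (hn : 1 < n)
    (hmin : ∀ i, min (ℓ i) (Nat.gcd n (ringChar (Rf i))) = 1) :
    IsPrincipalIdealRing (Polynomial (∀ i, Rf i) ⧸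
      Ideal.span {X ^ n - Polynomial.C lam}) := by
  classical
  have (i : ι) : IsPrincipalIdealRing (Rf i) := .of_ideal_le_total (hchain i)
  refine Polynomial.isPrincipalIdealRing_quotient_X_pow_sub_C (by omega)
    (Pi.isUnit_iff.2 hlam) fun M hM => ?_
  obtain ⟨i, hi⟩ := hM.exists_single_one_notMem
  have hnu : ∀ x ∈ M, ¬ IsUnit (x i) := by
    intro x hx hxu
    obtain ⟨v, hv⟩ := hxu.exists_left_inv
    refine hi ?_
    have hmem := M.mul_mem_left (Pi.single i v) hx
    rwa [← Pi.single_mul_left, hv] at hmem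
  by_cases hℓi : ℓ i = 1
  · left
    intro x hx
    have hπ : π i = 0 := by simpa [hℓi] using hnil i
    have hxi : x i = 0 := by
      have := Ideal.mem_jacobson_bot_of_not_isUnit (hchain i) (hnu x hx)
      rwa [hJ i, hπ, Ideal.mem_span_singleton, zero_dvd_iff] at this
    have hsub : 1 - (Pi.single i 1 : ∀ i, Rf i) ∈ M := by
      refine (hM.mem_or_mem (x := Pi.single i 1) ?_).resolve_left hi
      rw [← Pi.single_mul_left]
      simp
    have hx' : x = (1 - Pi.single i 1) * x := by
      rw [sub_mul, one_mul, ← Pi.single_mul_left, hxi]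
      simp
    rw [hx']
    exact Ideal.mul_mem_mul hsub hx
  · right
    intro hnM
    have hgcd : Nat.Coprime n (ringChar (Rf i)) := by
      have h1 := hmin i
      have h2 := hℓ i
      unfold Nat.Coprime
      omega
    refine hnu _ hnM ?_
    obtain ⟨a, b, hab⟩ := Nat.isCoprime_iff_coprime.2 hgcd
    have h1 := congrArg (Int.cast : ℤ → Rf i) hab
    push_cast at h1
    rw [ringChar.Nat.cast_ringChar, mul_zero, add_zero] at h1
    exact IsUnit.of_mul_eq_one_right (a : Rf i) (by simpa using h1)
end

section
/- Let R = R_1 ⊕ ⋯ ⊕ R_m be a finite commutative principal ideal ring, where each R_i is a finite chain ring whose Jacobson radical has nilpotency index ℓ_i. Let n > 1 be an integer and λ a unit of R with gcd(n, ord_{R^×}(λ)) = 1. Then R[X]/⟨X^n−λ⟩ is a principal ideal ring if and only if min{ℓ_i, gcd(n, char R_i)} = 1 for every i = 1, …, m. -/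
open Polynomial

theorem Ideal.isPrincipal_of_surjective_of_idempotent {A B : Type*} [CommRing A] [CommRing B]
    [IsPrincipalIdealRing B] (f : A →+* B) (hf : Function.Surjective f) {e : A}
    (he : e * e = e) (hker : ∀ x, f x = 0 → x * e = 0) {P : Ideal A} (hP : 1 - e ∈ P) :
    Submodule.IsPrincipal P := by
  obtain ⟨b, hb⟩ := IsPrincipalIdealRing.principal (P.map f)
  rw [← Ideal.span] at hb
  obtain ⟨g, hgP, rfl⟩ := (Ideal.mem_map_iff_of_surjective f hf).1
    (hb ▸ Ideal.mem_span_singleton_self b)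
  refine ⟨g * e + (1 - e), le_antisymm (fun x hx => ?_) ?_⟩
  · have h := Ideal.mem_map_of_mem f hx
    rw [hb, Ideal.mem_span_singleton'] at h
    obtain ⟨c, hc⟩ := h
    obtain ⟨c, rfl⟩ := hf c
    have h0 := hker (x - c * g) (by rw [map_sub, map_mul, hc, sub_self])
    refine Ideal.mem_span_singleton'.2 ⟨c * e + x * (1 - e), ?_⟩
    linear_combination (c * g - c - x * g + x) * he - h0
  · rw [Submodule.span_singleton_le_iff_mem]
    exact P.add_mem (P.mul_mem_right _ hgP) hP

theorem IsPrincipalIdealRing.of_isNilpotent_of_isRadical_span {A : Type*} [CommRing A]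
    [IsArtinianRing A] {p : A} (hp : IsNilpotent p) (hrad : (Ideal.span {p}).IsRadical) :
    IsPrincipalIdealRing A := by
  refine .of_prime fun P hP => ?_
  have hpP : p ∈ P := by
    obtain ⟨k, hk⟩ := hp
    exact hP.mem_of_pow_mem k (hk ▸ P.zero_mem)
  have : IsReduced (A ⧸ Ideal.span {p}) := (Ideal.isRadical_iff_quotient_reduced _).1 hrad
  have := IsArtinianRing.isSemisimpleRing_of_isReduced (A ⧸ Ideal.span {p})
  set mk := Ideal.Quotient.mk (Ideal.span {p}) with hmk
  have hsurj : Function.Surjective mk := Ideal.Quotient.mk_surjective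
  obtain ⟨e', he', hPe'⟩ := IsSemisimpleRing.ideal_eq_span_idempotent (P.map mk)
  have hnil : ∀ x ∈ RingHom.ker mk, IsNilpotent x := by
    intro x hx
    rw [hmk, Ideal.mk_ker, Ideal.mem_span_singleton'] at hx
    obtain ⟨c, rfl⟩ := hx
    exact (Commute.all c p).isNilpotent_mul_left hp
  obtain ⟨e, he, rfl⟩ := exists_isIdempotentElem_eq_of_ker_isNilpotent mk hnil e'
    (hsurj e') he'
  have heP : e ∈ P := by
    obtain ⟨y, hy, hye⟩ := (Ideal.mem_map_iff_of_surjective mk hsurj).1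
      (hPe' ▸ Ideal.mem_span_singleton_self (mk e))
    rw [hmk, Ideal.Quotient.eq, Ideal.mem_span_singleton'] at hye
    obtain ⟨c, hc⟩ := hye
    have : e = y - c * p := by rw [hc]; ring
    rw [this]
    exact P.sub_mem hy (P.mul_mem_left _ hpP)
  have he2 : e * e = e := he
  refine ⟨e + p * (1 - e), le_antisymm (fun x hx => ?_) ?_⟩
  · have h := Ideal.mem_map_of_mem mk hx
    rw [hPe', Ideal.mem_span_singleton'] at h
    obtain ⟨b, hb⟩ := h
    obtain ⟨b, rfl⟩ := hsurj b
    rw [← map_mul, eq_comm, hmk, Ideal.Quotient.eq, Ideal.mem_span_singleton'] at hb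
    obtain ⟨c, hc⟩ := hb
    refine Ideal.mem_span_singleton'.2 ⟨b * e + c * e * p + c * (1 - e), ?_⟩
    linear_combination hc + (b + c * p - c - p * b - p * p * c + c * p) * he2
  · rw [Submodule.span_singleton_le_iff_mem]
    exact P.add_mem heP (P.mul_mem_right _ hpP)

theorem IsLocalRing.of_ideals_total {R : Type*} [CommRing R] [Nontrivial R]
    (h : ∀ I J : Ideal R, I ≤ J ∨ J ≤ I) : IsLocalRing R := by
  obtain ⟨M, hM⟩ := Ideal.exists_maximal R
  refine .of_unique_max_ideal ⟨M, hM, fun N hN => ?_⟩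
  rcases h N M with h | h
  · exact hN.eq_of_le hM.ne_top h
  · exact (hM.eq_of_le hN.ne_top h).symm

theorem coprime_ringChar_of_isUnit_natCast {R : Type*} [CommRing R] [Finite R] {n : ℕ}
    (h : IsUnit (n : R)) : n.Coprime (ringChar R) := by
  have h0 : 0 < ringChar R := Nat.pos_of_ne_zero (CharP.ringChar_ne_zero_of_finite R)
  set d := n.gcd (ringChar R) with hd
  obtain ⟨a, ha⟩ := Nat.gcd_dvd_left n (ringChar R)
  obtain ⟨c, hc⟩ := Nat.gcd_dvd_right n (ringChar R)
  rw [← hd] at ha hc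
  have hdu : IsUnit (d : R) := by
    rw [ha, Nat.cast_mul] at h
    exact isUnit_of_mul_isUnit_left h
  have hdc : (d : R) * (c : R) = 0 := by
    rw [← Nat.cast_mul, ← hc, ringChar.Nat.cast_ringChar]
  have hdvd : ringChar R ∣ c := ringChar.dvd (hdu.mul_right_eq_zero.1 hdc)
  have hcpos : 0 < c := Nat.pos_of_ne_zero (by rintro rfl; omega)
  have hle := Nat.le_of_dvd hcpos hdvd
  have hdpos : 0 < d := Nat.pos_of_ne_zero (by intro h; rw [h] at hc; omega)
  change d = 1
  nlinarith

section Chain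

variable {R : Type*} [CommRing R]

theorem isPrincipalIdealRing_quotient_X_pow_sub_C_of_isUnit [IsLocalRing R] [Finite R] {p : R}
    (hp : IsLocalRing.maximalIdeal R = Ideal.span {p}) (hnil : IsNilpotent p) {n : ℕ}
    (hn : IsUnit (n : R)) {a : R} (ha : IsUnit a) :
    IsPrincipalIdealRing (R[X] ⧸ Ideal.span {X ^ n - C a}) := by
  have hn0 : n ≠ 0 := by rintro rfl; simp at hn
  have := (monic_X_pow_sub_C a hn0).finite_quotient
  have : IsArtinianRing (R[X] ⧸ Ideal.span {X ^ n - C a}) := IsArtinianRing.of_finite R _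
  set mk := Ideal.Quotient.mk (Ideal.span {X ^ n - C a}) with hmk
  refine .of_isNilpotent_of_isRadical_span (p := mk (C p)) ((hnil.map C).map mk) ?_
  let r := IsLocalRing.residue R
  have hsep : (X ^ n - C (r a)).Separable := separable_X_pow_sub_C _
    (by simpa using (hn.map r).ne_zero) (ha.map r).ne_zero
  rintro f ⟨m, hm⟩
  obtain ⟨f, rfl⟩ := Ideal.Quotient.mk_surjective f
  rw [← hmk, ← map_pow, Ideal.mem_span_singleton'] at hm
  obtain ⟨c, hc⟩ := hm
  obtain ⟨c, rfl⟩ := Ideal.Quotient.mk_surjective c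
  rw [← hmk, ← map_mul, eq_comm, hmk, Ideal.Quotient.eq, Ideal.mem_span_singleton'] at hc
  obtain ⟨q, hq⟩ := hc
  have hpr : r p = 0 := by
    rw [IsLocalRing.residue_eq_zero_iff, hp]
    exact Ideal.mem_span_singleton_self p
  have hdvd : X ^ n - C (r a) ∣ (f.map r) ^ m := by
    have := congrArg (Polynomial.map r) hq
    simp only [Polynomial.map_mul, Polynomial.map_sub, Polynomial.map_pow, map_X, map_C, hpr,
      map_zero, mul_zero, sub_zero] at this
    exact ⟨_, this.symm.trans (mul_comm _ _)⟩
  obtain ⟨g, hg⟩ := hsep.squarefree.isRadical m _ hdvd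
  obtain ⟨g, rfl⟩ := map_surjective r IsLocalRing.residue_surjective g
  have hmem : f - (X ^ n - C a) * g ∈ RingHom.ker (mapRingHom r) := by
    rw [RingHom.mem_ker]
    simp [hg]
  rw [ker_mapRingHom, IsLocalRing.ker_residue, hp, Ideal.map_span, Set.image_singleton,
    Ideal.mem_span_singleton'] at hmem
  obtain ⟨t, ht⟩ := hmem
  refine Ideal.mem_span_singleton'.2 ⟨mk t, ?_⟩
  rw [← map_mul, ht, hmk, Ideal.Quotient.eq, Ideal.mem_span_singleton']
  exact ⟨-g, by ring⟩

theorem eq_zero_of_isPrincipalIdealRing_quotient_X_pow_sub_C [IsLocalRing R] {p : R}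
    (hp : IsLocalRing.maximalIdeal R = Ideal.span {p}) {n : ℕ} (hn : ¬ IsUnit (n : R)) {b : R}
    (h : IsPrincipalIdealRing (R[X] ⧸ Ideal.span {X ^ n - C (b ^ n)})) : p = 0 := by
  set mk := Ideal.Quotient.mk (Ideal.span {X ^ n - C (b ^ n)}) with hmk
  have key : ∀ f g : R[X], mk f = mk g → ∃ q, f = g + q * (X ^ n - C (b ^ n)) := by
    intro f g hfg
    rw [hmk, Ideal.Quotient.eq, Ideal.mem_span_singleton'] at hfg
    obtain ⟨q, hq⟩ := hfg
    exact ⟨q, by rw [hq]; ring⟩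
  obtain ⟨G, hG⟩ := IsPrincipalIdealRing.principal (Ideal.span {mk (C p), mk (X - C b)})
  rw [← Ideal.span] at hG
  obtain ⟨g, rfl⟩ := Ideal.Quotient.mk_surjective G
  rw [← hmk] at hG
  have h1 : mk (C p) ∈ Ideal.span {mk g} := hG ▸ Ideal.subset_span (by simp)
  have h2 : mk (X - C b) ∈ Ideal.span {mk g} := hG ▸ Ideal.subset_span (by simp)
  have h3 : mk g ∈ Ideal.span {mk (C p), mk (X - C b)} :=
    hG ▸ Ideal.mem_span_singleton_self _
  rw [Ideal.mem_span_singleton'] at h1 h2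
  rw [Ideal.mem_span_pair] at h3
  obtain ⟨s, hs⟩ := h1
  obtain ⟨z, hz⟩ := h2
  obtain ⟨u, v, huv⟩ := h3
  obtain ⟨s, rfl⟩ := Ideal.Quotient.mk_surjective s
  obtain ⟨z, rfl⟩ := Ideal.Quotient.mk_surjective z
  obtain ⟨u, rfl⟩ := Ideal.Quotient.mk_surjective u
  obtain ⟨v, rfl⟩ := Ideal.Quotient.mk_surjective v
  simp only [← hmk, ← map_mul, ← map_add] at hs hz huv
  obtain ⟨q1, e1⟩ := key _ _ hs.symm
  obtain ⟨q2, e2⟩ := key _ _ hz.symm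
  obtain ⟨q3, e3⟩ := key _ _ huv.symm
  have d2 := congrArg (fun f => eval b (derivative f)) e2
  replace e1 := congrArg (eval b) e1
  replace e2 := congrArg (eval b) e2
  replace e3 := congrArg (eval b) e3
  simp only [eval_add, eval_mul, eval_sub, eval_pow, eval_X, eval_C, sub_self, mul_zero,
    add_zero] at e1 e2 e3
  simp only [derivative_add, derivative_mul, derivative_sub, derivative_X_pow, derivative_X,
    derivative_C, eval_add, eval_mul, eval_sub, eval_pow, eval_X, eval_C, sub_self, mul_zero,
    eval_one, sub_zero, zero_add] at d2
  have hnM : (n : R) ∈ IsLocalRing.maximalIdeal R := (IsLocalRing.mem_maximalIdeal _).2 hn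
  have hpM : p ∈ IsLocalRing.maximalIdeal R := hp ▸ Ideal.mem_span_singleton_self p
  have hzu : IsUnit (eval b z) := by
    by_contra hzn
    have hzM : eval b z ∈ IsLocalRing.maximalIdeal R := (IsLocalRing.mem_maximalIdeal _).2 hzn
    refine (Ideal.ne_top_iff_one _).1 (IsLocalRing.maximalIdeal.isMaximal R).ne_top ?_
    rw [d2, e3]
    exact Ideal.add_mem _ (Ideal.add_mem _ (Ideal.mul_mem_left _ _ (Ideal.mul_mem_left _ _ hpM))
      (Ideal.mul_mem_right _ _ hzM))
      (Ideal.mul_mem_left _ _ (Ideal.mul_mem_right _ _ hnM))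
  rw [e1, hzu.mul_right_eq_zero.1 e2.symm, mul_zero]

end Chain

section Pi

variable {ι : Type*} {R : ι → Type*} [∀ i, CommRing (R i)]

/-- Projection of `(∏ i, R i)[X] ⧸ (X ^ n - a)` to its `i`-th factor. -/
noncomputable def quotientXPowSubCProj (n : ℕ) (a : ∀ i, R i) (i : ι) :
    ((∀ i, R i)[X] ⧸ Ideal.span {X ^ n - C a}) →+*
      ((R i)[X] ⧸ Ideal.span {X ^ n - C (a i)}) :=
  Ideal.quotientMap _ (mapRingHom (Pi.evalRingHom R i)) <| by
    rw [Ideal.span_singleton_le_iff_mem, Ideal.mem_comap]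
    simp

theorem quotientXPowSubCProj_mk (n : ℕ) (a : ∀ i, R i) (i : ι) (f : (∀ i, R i)[X]) :
    quotientXPowSubCProj n a i (Ideal.Quotient.mk _ f) =
      Ideal.Quotient.mk _ (f.map (Pi.evalRingHom R i)) :=
  rfl

theorem quotientXPowSubCProj_surjective (n : ℕ) (a : ∀ i, R i) (i : ι) :
    Function.Surjective (quotientXPowSubCProj n a i) :=
  Ideal.quotientMap_surjective (map_surjective _ (Function.surjective_eval i))

theorem mul_C_single_eq_of_map_eq [DecidableEq ι] {i : ι} {f g : (∀ i, R i)[X]}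
    (h : f.map (Pi.evalRingHom R i) = g.map (Pi.evalRingHom R i)) :
    f * C (Pi.single i 1) = g * C (Pi.single i 1) := by
  ext k j
  rw [coeff_mul_C, coeff_mul_C, Pi.mul_apply, Pi.mul_apply]
  rcases eq_or_ne j i with rfl | hj
  · have := congrArg (fun q => coeff q k) h
    simp only [coeff_map, Pi.evalRingHom_apply] at this
    rw [this]
  · rw [Pi.single_eq_of_ne hj, mul_zero, mul_zero]

theorem mul_single_eq_zero_of_quotientXPowSubCProj_eq_zero [DecidableEq ι] {n : ℕ}
    {a : ∀ i, R i} {i : ι} {x : (∀ i, R i)[X] ⧸ Ideal.span {X ^ n - C a}}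
    (h : quotientXPowSubCProj n a i x = 0) :
    x * Ideal.Quotient.mk _ (C (Pi.single i 1)) = 0 := by
  obtain ⟨f, rfl⟩ := Ideal.Quotient.mk_surjective x
  rw [quotientXPowSubCProj_mk, Ideal.Quotient.eq_zero_iff_mem, Ideal.mem_span_singleton'] at h
  obtain ⟨q, hq⟩ := h
  obtain ⟨q, rfl⟩ := map_surjective (Pi.evalRingHom R i) (Function.surjective_eval i) q
  have hmap : f.map (Pi.evalRingHom R i) = (q * (X ^ n - C a)).map (Pi.evalRingHom R i) := by
    rw [← hq]
    simp
  rw [← map_mul, mul_C_single_eq_of_map_eq hmap, Ideal.Quotient.eq_zero_iff_mem,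
    Ideal.mem_span_singleton']
  exact ⟨q * C (Pi.single i 1), by ring⟩

theorem isPrincipalIdealRing_pi_quotient_X_pow_sub_C [Fintype ι] (n : ℕ) (a : ∀ i, R i)
    (h : ∀ i, IsPrincipalIdealRing ((R i)[X] ⧸ Ideal.span {X ^ n - C (a i)})) :
    IsPrincipalIdealRing ((∀ i, R i)[X] ⧸ Ideal.span {X ^ n - C a}) := by
  classical
  refine IsPrincipalIdealRing.of_prime
    (R := (∀ i, R i)[X] ⧸ Ideal.span {X ^ n - C a}) fun P hP => ?_
  let φ := (Ideal.Quotient.mk (Ideal.span {X ^ n - C a})).comp C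
  have hprod : ∏ i, (1 - Pi.single i 1 : ∀ i, R i) = 0 := by
    ext j
    rw [Finset.prod_apply]
    exact Finset.prod_eq_zero (Finset.mem_univ j) (by simp)
  have hmem : ∏ i, φ (1 - Pi.single i 1) ∈ P := by
    rw [← map_prod, hprod, map_zero]
    exact P.zero_mem
  obtain ⟨i, -, hi⟩ := hP.prod_mem_iff.1 hmem
  have := h i
  refine Ideal.isPrincipal_of_surjective_of_idempotent (quotientXPowSubCProj n a i)
    (quotientXPowSubCProj_surjective n a i) (e := φ (Pi.single i 1)) ?_
    (fun x hx => mul_single_eq_zero_of_quotientXPowSubCProj_eq_zero hx) ?_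
  · rw [← map_mul, ← Pi.single_mul, mul_one]
  · rwa [map_sub, map_one] at hi

end Pi

/-- Let `R = R_1 ⊕ ⋯ ⊕ R_m` be a finite commutative principal ideal ring, a product of
finite chain rings `R_i` whose Jacobson radicals have nilpotency indices `ℓ_i`; let `n > 1`
and `λ` a unit of `R` with `gcd(n, ord(λ)) = 1`.  Then `R[X]/⟨X^n−λ⟩` is a principal ideal
ring iff `min{ℓ_i, gcd(n, char R_i)} = 1` for every `i`. -/
theorem stmt_18 {ι : Type*} [Fintype ι] (Rf : ι → Type*)
    [∀ i, CommRing (Rf i)] [∀ i, Fintype (Rf i)]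
    (hchain : ∀ i, ∀ I J : Ideal (Rf i), I ≤ J ∨ J ≤ I)
    (π : ∀ i, Rf i)
    (hJ : ∀ i, Ideal.jacobson (⊥ : Ideal (Rf i)) = Ideal.span {π i})
    (ℓ : ι → ℕ) (hℓ : ∀ i, 0 < ℓ i)
    (hnil : ∀ i, (π i) ^ (ℓ i) = 0) (hnil' : ∀ i, (π i) ^ (ℓ i - 1) ≠ 0)
    (n : ℕ) (hn : 1 < n)
    (lam : (∀ i, Rf i)ˣ) (hcop : Nat.Coprime n (orderOf lam)) :
    IsPrincipalIdealRing (Polynomial (∀ i, Rf i) ⧸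
        Ideal.span {X ^ n - Polynomial.C ((lam : ∀ i, Rf i))}) ↔
      ∀ i, min (ℓ i) (Nat.gcd n (ringChar (Rf i))) = 1 := by
  have hnt : ∀ i, Nontrivial (Rf i) := fun i => ⟨_, _, hnil' i⟩
  have hloc : ∀ i, IsLocalRing (Rf i) := fun i => .of_ideals_total (hchain i)
  have hmax : ∀ i, IsLocalRing.maximalIdeal (Rf i) = Ideal.span {π i} := fun i => by
    rw [← hJ i, IsLocalRing.jacobson_eq_maximalIdeal ⊥ bot_ne_top]
  constructor
  · intro h i
    by_contra hmin
    have hchar := Nat.pos_of_ne_zero (CharP.ringChar_ne_zero_of_finite (Rf i))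
    have hgcd : 0 < n.gcd (ringChar (Rf i)) := Nat.gcd_pos_of_pos_right n hchar
    have hℓ2 : ℓ i - 1 ≠ 0 := by have := hℓ i; omega
    have hgcd1 : n.gcd (ringChar (Rf i)) ≠ 1 := by have := hℓ i; omega
    have hnu : ¬ IsUnit (n : Rf i) := fun hu => hgcd1 (coprime_ringChar_of_isUnit_natCast hu)
    obtain ⟨m, hm⟩ := exists_pow_eq_self_of_coprime hcop
    have hlam : (lam : ∀ i, Rf i) i = ((lam : ∀ i, Rf i) i ^ m) ^ n := by
      conv_lhs => rw [← hm]
      simp only [Units.val_pow_eq_pow_val, Pi.pow_apply]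
      exact pow_right_comm _ _ _
    have hi := IsPrincipalIdealRing.of_surjective _
      (quotientXPowSubCProj_surjective n (lam : ∀ i, Rf i) i)
    rw [hlam] at hi
    refine hnil' i ?_
    rw [eq_zero_of_isPrincipalIdealRing_quotient_X_pow_sub_C (hmax i) hnu hi, zero_pow hℓ2]
  · intro h
    refine isPrincipalIdealRing_pi_quotient_X_pow_sub_C n _ fun i => ?_
    have hu : IsUnit ((lam : ∀ i, Rf i) i) := lam.isUnit.map (Pi.evalRingHom Rf i)
    by_cases hℓ1 : ℓ i = 1
    · have hπ : π i = 0 := by simpa [hℓ1] using hnil i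
      have hf : IsField (Rf i) := by
        rw [IsLocalRing.isField_iff_maximalIdeal_eq, hmax i, hπ, Ideal.span_singleton_zero]
      let := hf.toField
      exact .of_surjective _ Ideal.Quotient.mk_surjective
    · have hco : n.Coprime (ringChar (Rf i)) := by
        have := h i
        rw [Nat.coprime_iff_gcd_eq_one]
        omega
      exact isPrincipalIdealRing_quotient_X_pow_sub_C_of_isUnit (hmax i) ⟨_, hnil i⟩
        (isUnit_natCast_of_coprime_ringChar hco) hu
end

section
/- Let p be a prime, s ≥ 1, and let R be a finite commutative local ring of characteristic p^s whose maximal ideal is generated by p (i.e. R is a Galois ring GR(p^s, r)). Set λ = 1 + p, a unit of R. Then 𝓡 = R[X]/⟨X^p−λ⟩ is a finite chain ring whose maximal ideal is generated by π = X − λ, with π of nilpotency index ps; moreover π^p = p·u for some unit u of 𝓡, and the residue field 𝓡/⟨π⟩ is isomorphic to the residue field of R. -/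
open Polynomial

/-- If the principal ideal generated by a nilpotent element is maximal, then the ideals of the
ring are linearly ordered. -/
theorem Ideal.le_total_of_isNilpotent_of_isMaximal_span {A : Type*} [CommRing A] {π : A}
    (hnil : IsNilpotent π) (hmax : (Ideal.span {π}).IsMaximal) (I J : Ideal A) :
    I ≤ J ∨ J ≤ I := by
  have unit_of : ∀ b : A, ¬ π ∣ b → IsUnit b := by
    intro b hb
    rw [← Ideal.mem_span_singleton] at hb
    obtain ⟨c, d, hd, h⟩ := hmax.exists_inv hb
    obtain ⟨e, rfl⟩ := Ideal.mem_span_singleton.mp hd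
    have h1 : IsUnit (1 - π * e) :=
      ((Commute.all π e).isNilpotent_mul_right hnil).isUnit_one_sub
    have h2 : 1 - π * e = c * b := by rw [← h]; ring
    rw [h2] at h1
    exact isUnit_of_mul_isUnit_right h1
  obtain ⟨n, hn⟩ := hnil
  have key : ∀ a : A, a ≠ 0 → ∃ k v, IsUnit v ∧ a = π ^ k * v := by
    intro a ha
    have hfin : FiniteMultiplicity π a := by
      refine ⟨n, fun h => ha ?_⟩
      rw [pow_succ, hn, zero_mul] at h
      exact zero_dvd_iff.mp h
    obtain ⟨v, hv, hnv⟩ := hfin.exists_eq_pow_mul_and_not_dvd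
    exact ⟨_, v, unit_of v hnv, hv⟩
  by_contra! hcon
  obtain ⟨a, haI, haJ⟩ := Set.not_subset.mp hcon.1
  obtain ⟨b, hbJ, hbI⟩ := Set.not_subset.mp hcon.2
  obtain ⟨k, v, hv, rfl⟩ := key a (fun h => haJ (h ▸ J.zero_mem))
  obtain ⟨j, w, hw, rfl⟩ := key b (fun h => hbI (h ▸ I.zero_mem))
  have hk : π ^ k ∈ I := (Ideal.mul_unit_mem_iff_mem I hv).mp haI
  have hj : π ^ j ∈ J := (Ideal.mul_unit_mem_iff_mem J hw).mp hbJ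
  rcases le_total k j with h | h
  · exact hbI (I.mul_mem_right _ (I.mem_of_dvd (pow_dvd_pow π h) hk))
  · exact haJ (J.mul_mem_right _ (J.mem_of_dvd (pow_dvd_pow π h) hj))

/-- If `p` is nilpotent and `x` is a `p`-th root of `1 + p`, then `(x - (1 + p)) ^ p` is
associated to `p`. -/
theorem exists_isUnit_sub_one_add_pow_prime_eq {A : Type*} [CommRing A] {p : ℕ} (hp : p.Prime)
    (hnil : IsNilpotent (p : A)) {x : A} (hx : x ^ p = 1 + p) :
    ∃ u : A, IsUnit u ∧ (x - (1 + p)) ^ p = p * u := by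
  set π : A := x - (1 + p) with hπ
  obtain ⟨c, hc⟩ : ∃ c : A, (π + (1 + p)) ^ p = π ^ p + (1 + p) ^ p + p * π * (1 + p) * c :=
    ⟨_, add_pow_prime_eq hp _ _⟩
  obtain ⟨d, hd⟩ : ∃ d : A, (1 + (p : A)) ^ p = 1 ^ p + (p : A) ^ p + p * 1 * p * d :=
    ⟨_, add_pow_prime_eq hp _ _⟩
  obtain ⟨m, hm⟩ := Nat.exists_eq_add_of_le hp.two_le
  have hpp : (p : A) ^ p = p * (p * (p : A) ^ m) := by
    conv_lhs => rw [hm, pow_add]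
    rw [← hm]; ring
  have hxπ : π + (1 + p) = x := by rw [hπ]; ring
  rw [hxπ, hx, hd, hpp, one_pow] at hc
  have heq : π ^ p = p * (1 - (p * ((p : A) ^ m + d) + π * ((1 + p) * c))) := by
    linear_combination -hc
  have hπnil : IsNilpotent π := by
    refine IsNilpotent.of_pow (m := p) ?_
    rw [heq]
    exact (Commute.all _ _).isNilpotent_mul_right hnil
  refine ⟨_, IsNilpotent.isUnit_one_sub ?_, heq⟩
  exact (Commute.all _ _).isNilpotent_add
    ((Commute.all _ _).isNilpotent_mul_right hnil)
    ((Commute.all _ _).isNilpotent_mul_right hπnil)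


/-- Let `p` be a prime, `s ≥ 1`, and `R` a finite commutative local ring of characteristic
`p^s` whose maximal ideal is generated by `p` (i.e. `R` is a Galois ring `GR(p^s, r)`).
Set `λ = 1 + p`, a unit of `R`.  Then `𝓡 = R[X]/⟨X^p−λ⟩` is a finite chain ring whose
maximal ideal is generated by `π = X − λ`, with `π` of nilpotency index `ps`; moreover
`π^p = p·u` for a unit `u` of `𝓡`, and the residue field `𝓡/⟨π⟩` is isomorphic to the
residue field of `R`. -/
theorem stmt_19 {R : Type*} [CommRing R] [Fintype R] [IsLocalRing R]
    (p s : ℕ) (hp : p.Prime) (hs : 1 ≤ s)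
    (hchar : ringChar R = p ^ s)
    (hmax : IsLocalRing.maximalIdeal R = Ideal.span {(p : R)}) :
    -- `λ = 1 + p` is a unit of `R`
    IsUnit ((1 : R) + (p : R)) ∧
    -- `𝓡` is a chain ring
    (∀ I J : Ideal (Polynomial R ⧸
        Ideal.span {X ^ p - Polynomial.C ((1 : R) + (p : R))}), I ≤ J ∨ J ≤ I) ∧
    -- its maximal ideal is generated by `π = X − λ`
    (Ideal.span {Ideal.Quotient.mk (Ideal.span {X ^ p - Polynomial.C ((1 : R) + (p : R))})
        (X - Polynomial.C ((1 : R) + (p : R)))}).IsMaximal ∧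
    -- `π` has nilpotency index `ps`
    (Ideal.Quotient.mk (Ideal.span {X ^ p - Polynomial.C ((1 : R) + (p : R))})
        (X - Polynomial.C ((1 : R) + (p : R)))) ^ (p * s) = 0 ∧
    (Ideal.Quotient.mk (Ideal.span {X ^ p - Polynomial.C ((1 : R) + (p : R))})
        (X - Polynomial.C ((1 : R) + (p : R)))) ^ (p * s - 1) ≠ 0 ∧
    -- `π^p = p·u` for a unit `u` of `𝓡`
    (∃ u : Polynomial R ⧸ Ideal.span {X ^ p - Polynomial.C ((1 : R) + (p : R))},
      IsUnit u ∧
      (Ideal.Quotient.mk (Ideal.span {X ^ p - Polynomial.C ((1 : R) + (p : R))})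
          (X - Polynomial.C ((1 : R) + (p : R)))) ^ p =
        (p : Polynomial R ⧸ Ideal.span {X ^ p - Polynomial.C ((1 : R) + (p : R))}) * u) ∧
    -- the residue field `𝓡/⟨π⟩` is isomorphic to the residue field of `R`
    Nonempty (((Polynomial R ⧸ Ideal.span {X ^ p - Polynomial.C ((1 : R) + (p : R))}) ⧸
        Ideal.span {Ideal.Quotient.mk (Ideal.span {X ^ p - Polynomial.C ((1 : R) + (p : R))})
          (X - Polynomial.C ((1 : R) + (p : R)))}) ≃+*
      (R ⧸ IsLocalRing.maximalIdeal R)) := by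
  have hp0 : (p : R) ^ s = 0 := by
    have h := CharP.cast_eq_zero R (ringChar R)
    rwa [hchar, Nat.cast_pow] at h
  have hp1 : (p : R) ^ (s - 1) ≠ 0 := by
    intro h
    rw [← Nat.cast_pow] at h
    have h' := ringChar.dvd h
    rw [hchar, Nat.pow_dvd_pow_iff_le_right hp.one_lt] at h'
    omega
  have hnil : IsNilpotent (p : R) := ⟨s, hp0⟩
  set l : R := 1 + (p : R) with hl
  set f : R[X] := X ^ p - C l with hf
  set q := Ideal.Quotient.mk (Ideal.span {f}) with hq
  set π := q (X - C l) with hπ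
  have hpA : q (C (p : R)) = p := by simp
  have hnilA : IsNilpotent (p : R[X] ⧸ Ideal.span {f}) := by
    rw [← hpA]
    exact (hnil.map C).map q
  have hroot : q X ^ p = 1 + p := by
    have h : q (X ^ p - C l) = 0 := Ideal.Quotient.eq_zero_iff_mem.mpr (Ideal.mem_span_singleton_self f)
    rw [map_sub, map_pow, sub_eq_zero] at h
    rw [h, hl]
    simp
  have hπx : π = q X - (1 + p) := by rw [hπ, hl]; simp
  obtain ⟨u, hu, hπp⟩ := exists_isUnit_sub_one_add_pow_prime_eq hp hnilA hroot
  rw [← hπx] at hπp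
  have hzero : π ^ (p * s) = 0 := by
    rw [pow_mul, hπp, mul_pow, ← hpA, ← map_pow, ← map_pow, hp0]
    simp
  have hmonic : f.Monic := monic_X_pow_sub_C l hp.ne_zero
  have hne : π ^ (p * s - 1) ≠ 0 := by
    have hexp : p * s - 1 = p * (s - 1) + (p - 1) := by
      obtain ⟨t, rfl⟩ := Nat.exists_eq_add_of_le hs
      have := hp.pos
      rw [Nat.add_sub_cancel_left, mul_add]
      omega
    rw [hexp, pow_add, pow_mul, hπp, mul_pow]
    intro h
    have h2 : (p : R[X] ⧸ Ideal.span {f}) ^ (s - 1) * π ^ (p - 1) = 0 := by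
      rw [← (hu.pow (s - 1)).mul_left_eq_zero, ← h]
      ring
    rw [← hpA, hπ, ← map_pow, ← map_pow, ← map_pow, ← map_mul, hq,
      Ideal.Quotient.eq_zero_iff_mem, Ideal.mem_span_singleton] at h2
    have hmon : ((X - C l) ^ (p - 1)).Monic := (monic_X_sub_C l).pow _
    have hdeg : ((X - C l) ^ (p - 1)).natDegree = p - 1 := by
      rw [(monic_X_sub_C l).natDegree_pow, natDegree_X_sub_C, mul_one]
    refine hmonic.not_dvd_of_natDegree_lt ?_ ?_ h2
    · intro h0
      have h3 := congrArg (fun g => g.coeff (p - 1)) h0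
      simp only [coeff_C_mul, coeff_zero] at h3
      have h4 := hmon.coeff_natDegree
      rw [hdeg] at h4
      rw [h4, mul_one] at h3
      exact hp1 h3
    · rw [natDegree_X_pow_sub_C]
      have := natDegree_C_mul_le ((p : R) ^ (s - 1)) ((X - C l) ^ (p - 1))
      have := hp.pos
      omega
  let ev : R[X] →+* R ⧸ IsLocalRing.maximalIdeal R :=
    (Ideal.Quotient.mk _).comp (evalRingHom l)
  have hpM : (p : R ⧸ IsLocalRing.maximalIdeal R) = 0 := by
    rw [← map_natCast (Ideal.Quotient.mk (IsLocalRing.maximalIdeal R)),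
      Ideal.Quotient.eq_zero_iff_mem, hmax]
    exact Ideal.mem_span_singleton_self _
  have hev : ∀ a ∈ Ideal.span {f}, ev a = 0 := by
    intro a ha
    obtain ⟨b, rfl⟩ := Ideal.mem_span_singleton.mp ha
    rw [map_mul]
    have : ev f = 0 := by simp [ev, hf, hl, hpM]
    rw [this, zero_mul]
  let φ := Ideal.Quotient.lift (Ideal.span {f}) ev hev
  have hφ : ∀ g, φ (q g) = Ideal.Quotient.mk _ (g.eval l) := fun g => rfl
  have hsurj : Function.Surjective φ := by
    intro y
    obtain ⟨r, rfl⟩ := Ideal.Quotient.mk_surjective y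
    exact ⟨q (C r), by rw [hφ, eval_C]⟩
  have hpπ : π ∣ (p : R[X] ⧸ Ideal.span {f}) := by
    rw [← hu.dvd_mul_right, ← hπp]
    exact dvd_pow_self π hp.ne_zero
  have hker : RingHom.ker φ = Ideal.span {π} := by
    apply le_antisymm
    · intro a ha
      obtain ⟨g, rfl⟩ := Ideal.Quotient.mk_surjective a
      rw [RingHom.mem_ker, hφ, Ideal.Quotient.eq_zero_iff_mem, hmax,
        Ideal.mem_span_singleton] at ha
      obtain ⟨r, hr⟩ := ha
      obtain ⟨h, hh⟩ := X_sub_C_dvd_sub_C_eval (a := l) (p := g)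
      rw [sub_eq_iff_eq_add, hr, C_mul] at hh
      rw [Ideal.mem_span_singleton, hh, map_add, map_mul, map_mul, hpA]
      exact dvd_add (dvd_mul_right _ _) (hpπ.mul_right _)
    · rw [Ideal.span_singleton_le_iff_mem, RingHom.mem_ker, hπ, hφ]
      simp
  have hmaxπ : (Ideal.span {π}).IsMaximal := by
    rw [← hker]
    let := Ideal.Quotient.field (IsLocalRing.maximalIdeal R)
    exact RingHom.ker_isMaximal_of_surjective φ hsurj
  exact ⟨hnil.isUnit_one_add,
    Ideal.le_total_of_isNilpotent_of_isMaximal_span ⟨_, hzero⟩ hmaxπ, hmaxπ, hzero, hne,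
    ⟨u, hu, hπp⟩,
    ⟨(Ideal.quotEquivOfEq hker.symm).trans (RingHom.quotientKerEquivOfSurjective hsurj)⟩⟩
end
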